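/- Assume Hypothesis (B): every involution on A₁ is conjugate to α. Let f be an endomorphism of A₁ with P = f(X), Q = f(Y) and image T = f(A₁). If there exists an involution Γ on A₁ such that Γ(P) = Q and Γ(Q) = P, then f is an automorphism of A₁. -/

import Mathlib

noncomputable section

/-- `f : A → A` is a `K`-algebra endomorphism (as a bare function). -/
def IsAlgEndo (K : Type) [CommSemiring K] {A : Type} [Semiring A] [Algebra K A]
    (f : A → A) : Prop :=
  (∀ a b : A, f (a + b) = f a + f b) ∧
  (∀ (c : K) (a : A), f (c • a) = c • f a) ∧
  (∀ a b : A, f (a * b) = f a * f b) ∧ f 1 = 1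

/-- `f : A → A` is a `K`-algebra automorphism: a bijective endomorphism. -/
def IsAlgAuto (K : Type) [CommSemiring K] {A : Type} [Semiring A] [Algebra K A]
    (f : A → A) : Prop :=
  IsAlgEndo K f ∧ Function.Bijective f

/-- `f : A → A` is a `K`-linear anti-endomorphism. -/
def IsAntiEndo (K : Type) [CommSemiring K] {A : Type} [Semiring A] [Algebra K A]
    (f : A → A) : Prop :=
  (∀ a b : A, f (a + b) = f a + f b) ∧
  (∀ (c : K) (a : A), f (c • a) = c • f a) ∧
  (∀ a b : A, f (a * b) = f b * f a) ∧ f 1 = 1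

/-- `f : A → A` is an anti-automorphism: a bijective anti-endomorphism. -/
def IsAntiAuto (K : Type) [CommSemiring K] {A : Type} [Semiring A] [Algebra K A]
    (f : A → A) : Prop :=
  IsAntiEndo K f ∧ Function.Bijective f

/-- An involution on a `K`-algebra: an anti-automorphism of order at most two. -/
def IsInvolutionOn (K : Type) [CommSemiring K] {A : Type} [Semiring A] [Algebra K A]
    (γ : A → A) : Prop :=
  IsAntiAuto K γ ∧ γ ∘ γ = id

/-- The defining relation of the first Weyl algebra: `Y*X = X*Y + 1`. -/
inductive WeylRel (K : Type) [CommSemiring K] :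
    FreeAlgebra K (Fin 2) → FreeAlgebra K (Fin 2) → Prop
  | rel : WeylRel K (FreeAlgebra.ι K 1 * FreeAlgebra.ι K 0)
      (FreeAlgebra.ι K 0 * FreeAlgebra.ι K 1 + 1)

/-- The first Weyl algebra `A₁(K) = K⟨X,Y⟩/(YX - XY - 1)`. -/
abbrev Weyl (K : Type) [CommSemiring K] : Type := RingQuot (WeylRel K)

/-- The generator `X` of the Weyl algebra. -/
def Wx (K : Type) [CommSemiring K] : Weyl K :=
  RingQuot.mkAlgHom K (WeylRel K) (FreeAlgebra.ι K 0)

/-- The generator `Y` of the Weyl algebra. -/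
def Wy (K : Type) [CommSemiring K] : Weyl K :=
  RingQuot.mkAlgHom K (WeylRel K) (FreeAlgebra.ι K 1)

/-- `α` is the exchange involution: the involution with `α X = Y` and `α Y = X`. -/
def IsExchange (K : Type) [CommSemiring K] (α : Weyl K → Weyl K) : Prop :=
  IsInvolutionOn K α ∧ α (Wx K) = Wy K ∧ α (Wy K) = Wx K

/-- `γ` is conjugate to `α` by an automorphism or an anti-automorphism:
`γ = g⁻¹ ∘ α ∘ g`. -/
def ConjToAlpha (K : Type) [CommSemiring K] (α γ : Weyl K → Weyl K) : Prop :=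
  ∃ g : Weyl K → Weyl K, (IsAlgAuto K g ∨ IsAntiAuto K g) ∧
    γ = Function.invFun g ∘ α ∘ g

section Helpers

open Polynomial

set_option linter.unusedSectionVars false

section Part1

section basics
variable {R : Type} [CommRing R]

theorem W_rel (R : Type) [CommRing R] : Wy R * Wx R = Wx R * Wy R + 1 := by
  have := RingQuot.mkAlgHom_rel R (WeylRel.rel (K := R))
  simpa [Wx, Wy] using this

def wlift {B : Type} [Ring B] [Algebra R B] (x y : B) (h : y * x = x * y + 1) :
    Weyl R →ₐ[R] B :=
  RingQuot.liftAlgHom R ⟨FreeAlgebra.lift R ![x, y], by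
    rintro _ _ ⟨⟩
    simpa using h⟩

@[simp] theorem wlift_x {B : Type} [Ring B] [Algebra R B] (x y : B) (h : y * x = x * y + 1) :
    wlift (R := R) x y h (Wx R) = x := by
  simp [wlift, Wx]

@[simp] theorem wlift_y {B : Type} [Ring B] [Algebra R B] (x y : B) (h : y * x = x * y + 1) :
    wlift (R := R) x y h (Wy R) = y := by
  simp [wlift, Wy]

theorem W_hom_ext {B : Type} [Semiring B] [Algebra R B] {f g : Weyl R →ₐ[R] B}
    (hx : f (Wx R) = g (Wx R)) (hy : f (Wy R) = g (Wy R)) : f = g := by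
  apply RingQuot.ringQuot_ext'
  apply FreeAlgebra.hom_ext
  funext i
  fin_cases i
  · simpa [Wx] using hx
  · simpa [Wy] using hy

theorem W_adjoin : Algebra.adjoin R {Wx R, Wy R} = ⊤ := by
  have hx : Wx R ∈ Algebra.adjoin R {Wx R, Wy R} := Algebra.subset_adjoin (by simp)
  have hy : Wy R ∈ Algebra.adjoin R {Wx R, Wy R} := Algebra.subset_adjoin (by simp)
  let g : Weyl R →ₐ[R] Algebra.adjoin R {Wx R, Wy R} :=
    wlift (B := Algebra.adjoin R {Wx R, Wy R}) ⟨Wx R, hx⟩ ⟨Wy R, hy⟩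
      (Subtype.ext (by simpa using W_rel R))
  have : (Algebra.adjoin R {Wx R, Wy R}).val.comp g = AlgHom.id R _ := by
    apply W_hom_ext <;> simp [g]
  rw [eq_top_iff]
  intro w _
  have h2 := DFunLike.congr_fun this w
  simp at h2
  rw [← h2]
  exact (g w).2

/-- left induction principle -/
theorem W_induction {p : Weyl R → Prop} (w : Weyl R) (h1 : p 1)
    (hadd : ∀ a b, p a → p b → p (a + b)) (hs : ∀ (c : R) a, p a → p (c • a))
    (hx : ∀ a, p a → p (Wx R * a)) (hy : ∀ a, p a → p (Wy R * a)) : p w := by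
  have key : ∀ u ∈ Algebra.adjoin R {Wx R, Wy R}, ∀ a, p a → p (u * a) := by
    intro u hu
    induction hu using Algebra.adjoin_induction with
    | mem x h =>
      rcases h with rfl | rfl
      · exact hx
      · exact hy
    | algebraMap r => intro a ha; rw [← Algebra.smul_def]; exact hs r a ha
    | add x y _ _ h1 h2 => intro a ha; rw [add_mul]; exact hadd _ _ (h1 a ha) (h2 a ha)
    | mul x y _ _ h1 h2 => intro a ha; rw [mul_assoc]; exact h1 _ (h2 a ha)
  have := key w (by rw [W_adjoin]; trivial) 1 h1
  simpa using this

abbrev PP (R : Type) [CommRing R] := Polynomial (Polynomial R)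

def rep (R : Type) [CommRing R] : Weyl R →ₐ[R] Module.End (Polynomial R) (PP R) :=
  wlift (B := Module.End (Polynomial R) (PP R)) (LinearMap.mulLeft (Polynomial R) (X : PP R))
    (LinearMap.mulLeft (Polynomial R) (C X : PP R) + Polynomial.derivative) (by
    apply LinearMap.ext; intro m
    simp [Polynomial.derivative_mul]; ring)

def sym (w : Weyl R) : PP R := rep R w 1

@[simp] theorem rep_x (m : PP R) : rep R (Wx R) m = X * m := by simp [rep]
@[simp] theorem rep_y (m : PP R) : rep R (Wy R) m = C X * m + derivative m := by simp [rep]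

theorem sym_mul (a b : Weyl R) : sym (a * b) = rep R a (sym b) := by simp [sym]
@[simp] theorem sym_xmul (b : Weyl R) : sym (Wx R * b) = X * sym b := by simp [sym_mul]
@[simp] theorem sym_ymul (b : Weyl R) : sym (Wy R * b) = C X * sym b + derivative (sym b) := by
  simp [sym_mul]
@[simp] theorem sym_one : sym (1 : Weyl R) = 1 := by simp [sym]
@[simp] theorem sym_zero : sym (0 : Weyl R) = 0 := by simp [sym]
@[simp] theorem sym_add (a b : Weyl R) : sym (a + b) = sym a + sym b := by simp [sym]
@[simp] theorem sym_sub (a b : Weyl R) : sym (a - b) = sym a - sym b := by simp [sym]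
@[simp] theorem sym_smul (c : R) (a : Weyl R) : sym (c • a) = c • sym a := by simp [sym]

def symL (R : Type) [CommRing R] : Weyl R →ₗ[R] PP R where
  toFun := sym
  map_add' := sym_add
  map_smul' := sym_smul

theorem sym_sum {ι : Type*} (s : Finset ι) (f : ι → Weyl R) :
    sym (∑ i ∈ s, f i) = ∑ i ∈ s, sym (f i) := map_sum (symL R) f s

theorem sym_xpow_mul (n : ℕ) (b : Weyl R) : sym (Wx R ^ n * b) = X ^ n * sym b := by
  induction n with
  | zero => simp
  | succ n ih => rw [pow_succ', mul_assoc, sym_xmul, ih, pow_succ', mul_assoc]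

theorem sym_ypow (n : ℕ) : sym (Wy R ^ n) = C (X ^ n) := by
  induction n with
  | zero => simp
  | succ n ih => rw [pow_succ', sym_ymul, ih, derivative_C]; simp [pow_succ']

/-- normal ordering -/
def nu (m : PP R) : Weyl R := m.sum fun i q => Wx R ^ i * aeval (Wy R) q

theorem sym_aeval_y (q : Polynomial R) : sym (aeval (Wy R) q) = C q := by
  induction q using Polynomial.induction_on' with
  | add p q hp hq => simp [hp, hq]
  | monomial n a =>
    rw [aeval_monomial, ← Algebra.smul_def, sym_smul, sym_ypow, smul_C, smul_eq_C_mul,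
      C_mul_X_pow_eq_monomial]

theorem sym_nu (m : PP R) : sym (nu m) = m := by
  rw [nu, Polynomial.sum, sym_sum]
  conv_rhs => rw [← Polynomial.sum_C_mul_X_pow_eq m, Polynomial.sum]
  refine Finset.sum_congr rfl fun i _ => ?_
  rw [sym_xpow_mul, sym_aeval_y, mul_comm]

theorem nu_add (a b : PP R) : nu (a + b) = nu a + nu b := by
  rw [nu, nu, nu, Polynomial.sum_add_index]
  · simp
  · intros; simp [mul_add]

theorem nu_monomial (i : ℕ) (q : Polynomial R) : nu (monomial i q) = Wx R ^ i * aeval (Wy R) q := by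
  rw [nu, Polynomial.sum_monomial_index]; simp

theorem nu_smul (c : R) (m : PP R) : nu (c • m) = c • nu m := by
  induction m using Polynomial.induction_on' with
  | add p q hp hq => simp [nu_add, hp, hq]
  | monomial n a => rw [smul_monomial, nu_monomial, nu_monomial]; simp

theorem y_xpow (i : ℕ) : Wy R * Wx R ^ i = Wx R ^ i * Wy R + (i : Weyl R) * Wx R ^ (i - 1) := by
  induction i with
  | zero => simp
  | succ n ih =>
    rw [pow_succ, ← mul_assoc, ih, add_mul, mul_assoc _ (Wy R), W_rel]
    rcases n with _ | n
    · simp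
    · simp [pow_succ, mul_add, add_mul, mul_assoc]; abel

theorem nu_x (m : PP R) : Wx R * nu m = nu (X * m) := by
  induction m using Polynomial.induction_on' with
  | add p q hp hq => simp [nu_add, mul_add, hp, hq]
  | monomial n a => rw [X_mul_monomial, nu_monomial, nu_monomial, pow_succ', mul_assoc]

theorem nu_y (m : PP R) : Wy R * nu m = nu (C X * m + derivative m) := by
  induction m using Polynomial.induction_on' with
  | add p q hp hq =>
    rw [nu_add, mul_add, hp, hq, ← nu_add]; congr 1; simp [mul_add]; abel
  | monomial n a =>
    rw [C_mul_monomial, derivative_monomial, nu_add, nu_monomial, nu_monomial, nu_monomial,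
      ← mul_assoc, y_xpow, add_mul]
    simp [mul_assoc]
    rw [← mul_assoc, (Nat.cast_commute n (Wx R ^ (n-1))).eq, mul_assoc,
      (Nat.cast_commute n (aeval (Wy R) a)).eq]

theorem nu_sym (w : Weyl R) : nu (sym w) = w := by
  induction w using W_induction with
  | h1 => rw [sym_one, ← C_1, ← monomial_zero_left, nu_monomial]; simp
  | hadd a b ha hb => rw [sym_add, nu_add, ha, hb]
  | hs c a ha => rw [sym_smul, nu_smul, ha]
  | hx a ha => rw [sym_xmul, ← nu_x, ha]
  | hy a ha => rw [sym_ymul, ← nu_y, ha]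

theorem sym_inj {a b : Weyl R} (h : sym a = sym b) : a = b := by
  rw [← nu_sym a, h, nu_sym]

theorem sym_mul_aeval (w : Weyl R) (q : Polynomial R) : sym (w * aeval (Wy R) q) = q • sym w := by
  rw [sym_mul, sym_aeval_y, sym, ← map_smul]; congr 1; simp [smul_eq_C_mul]

theorem sym_ady (w : Weyl R) : sym (Wy R * w - w * Wy R) = derivative (sym w) := by
  have := sym_mul_aeval w X
  rw [aeval_X] at this
  rw [sym_sub, this, sym_ymul, smul_eq_C_mul]; ring

theorem sym_adx (w : Weyl R) (i : ℕ) :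
    (sym (w * Wx R - Wx R * w)).coeff i = derivative ((sym w).coeff i) := by
  induction w using W_induction generalizing i with
  | h1 => simp [coeff_one]; split_ifs <;> simp
  | hadd a b ha hb =>
    have : (a + b) * Wx R - Wx R * (a + b) = (a * Wx R - Wx R * a) + (b * Wx R - Wx R * b) := by
      noncomm_ring
    rw [this, sym_add, coeff_add, ha, hb]; simp
  | hs c a ha =>
    have : (c • a) * Wx R - Wx R * (c • a) = c • (a * Wx R - Wx R * a) := by
      simp [smul_sub]
    rw [this, sym_smul, coeff_smul, ha]; simp
  | hx a ha =>
    have : (Wx R * a) * Wx R - Wx R * (Wx R * a) = Wx R * (a * Wx R - Wx R * a) := by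
      simp [mul_sub, mul_assoc]
    rw [this, sym_xmul, sym_xmul]
    rcases i with _ | i
    · simp
    · rw [coeff_X_mul, coeff_X_mul, ha]
  | hy a ha =>
    have : (Wy R * a) * Wx R - Wx R * (Wy R * a) = Wy R * (a * Wx R - Wx R * a) + a := by
      have h : Wy R * (Wx R * a) = Wx R * (Wy R * a) + a := by
        rw [← mul_assoc, W_rel, add_mul, one_mul, mul_assoc]
      rw [mul_sub, h, mul_assoc]; abel
    rw [this, sym_add, sym_ymul, sym_ymul, coeff_add, coeff_add, coeff_add, coeff_C_mul,
      coeff_C_mul, coeff_derivative, coeff_derivative, ha, ha]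
    simp [derivative_mul]; ring

end basics

end Part1

section Part2

section basechange
variable {R S : Type} [CommRing R] [CommRing S]

def wmap (φ : R →+* S) : Weyl R →+* Weyl S :=
  letI : Algebra R (Weyl S) := Algebra.compHom _ φ
  (wlift (R := R) (Wx S) (Wy S) (W_rel S)).toRingHom

@[simp] theorem wmap_x (φ : R →+* S) : wmap φ (Wx R) = Wx S :=
  letI : Algebra R (Weyl S) := Algebra.compHom _ φ
  wlift_x (R := R) (Wx S) (Wy S) (W_rel S)

@[simp] theorem wmap_y (φ : R →+* S) : wmap φ (Wy R) = Wy S :=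
  letI : Algebra R (Weyl S) := Algebra.compHom _ φ
  wlift_y (R := R) (Wx S) (Wy S) (W_rel S)

theorem wmap_smul (φ : R →+* S) (c : R) (a : Weyl R) : wmap φ (c • a) = φ c • wmap φ a :=
  letI : Algebra R (Weyl S) := Algebra.compHom _ φ
  map_smul (wlift (R := R) (Wx S) (Wy S) (W_rel S)) c a

theorem sym_wmap (φ : R →+* S) (w : Weyl R) : sym (wmap φ w) = (sym w).map (mapRingHom φ) := by
  induction w using W_induction with
  | h1 => simp
  | hadd a b ha hb => simp [ha, hb]
  | hs c a ha =>
    rw [wmap_smul, sym_smul, sym_smul, ha]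
    ext i j
    simp
  | hx a ha => simp [ha]
  | hy a ha => simp [ha, derivative_map]

theorem coeff_wmap (φ : R →+* S) (w : Weyl R) (i j : ℕ) :
    ((sym (wmap φ w)).coeff i).coeff j = φ (((sym w).coeff i).coeff j) := by
  rw [sym_wmap]; simp

theorem wmap_injective (φ : R →+* S) (h : Function.Injective φ) : Function.Injective (wmap φ) := by
  intro a b hab
  apply sym_inj
  ext i j
  apply h
  rw [← coeff_wmap, hab, coeff_wmap]

end basechange

section transp
variable {R S : Type} [CommRing R] [CommRing S]

def trH (R : Type) [CommRing R] : Weyl R →ₐ[R] (Weyl R)ᵐᵒᵖ :=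
  wlift (B := (Weyl R)ᵐᵒᵖ) (MulOpposite.op (Wx R)) (MulOpposite.op (-(Wy R))) (by
    apply MulOpposite.unop_injective
    have h : Wx R * (-Wy R) = (-Wy R) * Wx R + 1 := by
      have e1 : Wx R * (-Wy R) = -(Wx R * Wy R) := mul_neg (Wx R) (Wy R)
      have e2 : (-Wy R) * Wx R = -(Wy R * Wx R) := neg_mul (Wy R) (Wx R)
      rw [e1, e2, W_rel]; abel
    exact h)

def tr (w : Weyl R) : Weyl R := (trH R w).unop

@[simp] theorem tr_x : tr (Wx R) = Wx R := by simp [tr, trH]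
@[simp] theorem tr_y : tr (Wy R) = -Wy R := by simp [tr, trH]
@[simp] theorem tr_mul (a b : Weyl R) : tr (a * b) = tr b * tr a := by simp [tr]
@[simp] theorem tr_add (a b : Weyl R) : tr (a + b) = tr a + tr b := by simp [tr]
@[simp] theorem tr_one : tr (1 : Weyl R) = 1 := by simp [tr]
@[simp] theorem tr_smul (c : R) (a : Weyl R) : tr (c • a) = c • tr a := by simp [tr]
@[simp] theorem tr_pow (a : Weyl R) (n : ℕ) : tr (a ^ n) = tr a ^ n := by simp [tr]
theorem tr_sum {ι : Type*} (s : Finset ι) (f : ι → Weyl R) :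
    tr (∑ i ∈ s, f i) = ∑ i ∈ s, tr (f i) := by
  simp [tr]

theorem tr_wmap (φ : R →+* S) (w : Weyl R) : tr (wmap φ w) = wmap φ (tr w) := by
  induction w using W_induction with
  | h1 => simp
  | hadd a b ha hb => simp [ha, hb]
  | hs c a ha => rw [wmap_smul, tr_smul, ha, tr_smul, wmap_smul]
  | hx a ha => simp [ha]
  | hy a ha => simp [ha]

end transp

section degrees
variable {R : Type} [CommRing R]

def tdeg (N : ℕ) (m : PP R) : Prop := ∀ i j, N < i + j → (m.coeff i).coeff j = 0

theorem tdeg.add {N : ℕ} {m n : PP R} (h : tdeg N m) (h' : tdeg N n) : tdeg N (m + n) := by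
  intro i j hij; simp [h i j hij, h' i j hij]

theorem tdeg.smul {N : ℕ} {m : PP R} (c : R) (h : tdeg N m) : tdeg N (c • m) := by
  intro i j hij; simp [h i j hij]

theorem tdeg.mono {N M : ℕ} {m : PP R} (h : tdeg N m) (hM : N ≤ M) : tdeg M m :=
  fun i j hij => h i j (by omega)

theorem tdeg.x {N : ℕ} {m : PP R} (h : tdeg N m) : tdeg (N + 1) (rep R (Wx R) m) := by
  rintro (_ | i) j hij
  · simp
  · simp [h i j (by omega)]

theorem tdeg.y {N : ℕ} {m : PP R} (h : tdeg N m) : tdeg (N + 1) (rep R (Wy R) m) := by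
  rintro i (_ | j) hij
  · simp [coeff_derivative]
    have := h (i+1) 0 (by omega)
    rw [this, zero_mul]
  · have h1 := h (i+1) (j+1) (by omega)
    have h2 := h i j (by omega)
    have e : ((i : R[X]) + 1) = ((i + 1 : ℕ) : R[X]) := by push_cast; rfl
    rw [rep_y, coeff_add, coeff_C_mul, coeff_add, coeff_X_mul, h2, coeff_derivative,
      e, coeff_mul_natCast, h1]; simp

theorem tdeg.xy {N : ℕ} {m : PP R} (h : tdeg N m) (i j : ℕ) :
    tdeg (N + i + j) (rep R (Wx R ^ i * Wy R ^ j) m) := by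
  have hy : tdeg (N + j) (rep R (Wy R ^ j) m) := by
    induction j with
    | zero => simpa using h
    | succ j ih => rw [pow_succ', map_mul]; exact ih.y
  induction i with
  | zero => simpa using hy
  | succ i ih =>
    rw [pow_succ', mul_assoc, map_mul]
    exact ih.x.mono (by omega)

theorem sym_xy (i j : ℕ) : sym (Wx R ^ i * Wy R ^ j) = monomial i (monomial j 1) := by
  rw [sym_xpow_mul, sym_ypow, mul_comm, C_mul_X_pow_eq_monomial, ← monomial_one_right_eq_X_pow]

theorem coeff_sym_xy (i j a b : ℕ) : ((sym (Wx R ^ i * Wy R ^ j)).coeff a).coeff b =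
    if i = a ∧ j = b then 1 else 0 := by
  rw [sym_xy, coeff_monomial]
  by_cases h : i = a <;> simp [h, coeff_monomial]

theorem eq_sum_of_bound {w : Weyl R} (n : ℕ)
    (h : ∀ i j, ((sym w).coeff i).coeff j ≠ 0 → i < n ∧ j < n) :
    w = ∑ i ∈ Finset.range n, ∑ j ∈ Finset.range n,
      ((sym w).coeff i).coeff j • (Wx R ^ i * Wy R ^ j) := by
  apply sym_inj
  ext a b
  simp only [sym_sum, sym_smul, finsetSum_coeff, coeff_smul, coeff_sym_xy]
  by_cases hab : ((sym w).coeff a).coeff b = 0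
  · rw [hab, Finset.sum_eq_zero]
    intro i _
    rw [Finset.sum_eq_zero]
    intro j _
    split_ifs with h1
    · obtain ⟨rfl, rfl⟩ := h1; simp [hab]
    · simp
  · obtain ⟨ha, hb⟩ := h a b hab
    rw [Finset.sum_eq_single a, Finset.sum_eq_single b]
    · simp
    · intro j _ hj; simp [hj]
    · simp [hb]
    · intro i _ hi; simp [hi]
    · simp [ha]

theorem eq_sum_of_tdeg {w : Weyl R} {N : ℕ} (h : tdeg N (sym w)) :
    w = ∑ i ∈ Finset.range (N+1), ∑ j ∈ Finset.range (N+1),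
      ((sym w).coeff i).coeff j • (Wx R ^ i * Wy R ^ j) := by
  apply eq_sum_of_bound
  intro i j hij
  by_contra hc
  exact hij (h i j (by omega))

theorem exists_tdeg (m : PP R) : ∃ N, tdeg N m := by
  induction m using Polynomial.induction_on' with
  | add p q hp hq =>
    obtain ⟨N, hN⟩ := hp
    obtain ⟨M, hM⟩ := hq
    exact ⟨N + M, (hN.mono (by omega)).add (hM.mono (by omega))⟩
  | monomial n a =>
    refine ⟨n + a.natDegree, fun i j hij => ?_⟩
    rw [coeff_monomial]
    split_ifs with h
    · exact coeff_eq_zero_of_natDegree_lt (by omega)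
    · simp

theorem tdeg_zero (N : ℕ) : tdeg N (0 : PP R) := by intro i j _; simp

theorem tdeg.sum {ι : Type*} {N : ℕ} (s : Finset ι) (f : ι → PP R) (h : ∀ i ∈ s, tdeg N (f i)) :
    tdeg N (∑ i ∈ s, f i) := by
  classical
  induction s using Finset.induction_on with
  | empty => simpa using tdeg_zero N
  | insert a s ha ih =>
    rw [Finset.sum_insert ha]
    exact (h a (by simp)).add (ih fun i hi => h i (by simp [hi]))

theorem tdeg_mul {a b : Weyl R} {N M : ℕ} (ha : tdeg N (sym a)) (hb : tdeg M (sym b)) :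
    tdeg (N + M) (sym (a * b)) := by
  rw [eq_sum_of_tdeg ha, Finset.sum_mul, sym_sum]
  apply tdeg.sum
  intro i _
  rw [Finset.sum_mul, sym_sum]
  apply tdeg.sum
  intro j _
  rw [smul_mul_assoc, sym_smul]
  by_cases h : N < i + j
  · rw [ha i j h, zero_smul]; exact tdeg_zero _
  · apply tdeg.smul
    rw [sym_mul]
    exact (hb.xy i j).mono (by omega)

theorem tdeg_pow {a : Weyl R} {N : ℕ} (ha : tdeg N (sym a)) (p : ℕ) :
    tdeg (p * N) (sym (a ^ p)) := by
  induction p with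
  | zero =>
    intro i j hij
    rw [pow_zero, sym_one, coeff_one]
    split_ifs with h
    · rw [coeff_one]; split_ifs with h' <;> [omega; rfl]
    · simp
  | succ p ih => rw [pow_succ]; exact (tdeg_mul ih ha).mono (by rw [Nat.succ_mul])

/-! x-degree -/

theorem rep_aeval_y (q : Polynomial R) {m : PP R} {d : ℕ} (hm : m.natDegree ≤ d) :
    (rep R (aeval (Wy R) q) m).natDegree ≤ d ∧
    (rep R (aeval (Wy R) q) m).coeff d = q * m.coeff d := by
  induction q using Polynomial.induction_on with
  | C a =>
    have : rep R (aeval (Wy R) (C a)) m = a • m := by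
      rw [aeval_C, AlgHom.commutes]; rfl
    rw [this]
    exact ⟨(natDegree_smul_le a m).trans hm, by simp [smul_eq_C_mul]⟩
  | add p q hp hq =>
    rw [map_add, map_add, LinearMap.add_apply, coeff_add]
    exact ⟨(natDegree_add_le _ _).trans (max_le hp.1 hq.1), by rw [hp.2, hq.2, add_mul]⟩
  | monomial n a ih =>
    have : rep R (aeval (Wy R) (C a * X ^ (n+1))) m
        = C X * rep R (aeval (Wy R) (C a * X ^ n)) m
          + derivative (rep R (aeval (Wy R) (C a * X ^ n)) m) := by
      rw [← rep_y, ← Module.End.mul_apply, ← map_mul]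
      congr 2
      rw [pow_succ, mul_comm (X ^ n) X, ← mul_assoc, mul_comm (C a) X, mul_assoc, map_mul, aeval_X]
    rw [this]
    refine ⟨(natDegree_add_le _ _).trans (max_le ?_ ?_), ?_⟩
    · exact (natDegree_C_mul_le _ _).trans ih.1
    · exact (natDegree_derivative_le _).trans (by omega)
    · rw [coeff_add, coeff_C_mul, ih.2, coeff_derivative,
        coeff_eq_zero_of_natDegree_lt (lt_of_le_of_lt ih.1 (Nat.lt_succ_self d))]
      ring

theorem rep_top (a : Weyl R) {m : PP R} {n d : ℕ} (ha : (sym a).natDegree ≤ n)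
    (hm : m.natDegree ≤ d) :
    (rep R a m).natDegree ≤ n + d ∧ (rep R a m).coeff (n + d) = (sym a).coeff n * m.coeff d := by
  have ea : a = ∑ i ∈ Finset.range (n+1), Wx R ^ i * aeval (Wy R) ((sym a).coeff i) := by
    conv_lhs => rw [← nu_sym a]
    rw [nu, Polynomial.sum_over_range' _ (by simp) (n+1) (by omega)]
  have hx : ∀ i (k : PP R), rep R (Wx R ^ i) k = X ^ i * k := by
    intro i k
    induction i with
    | zero => simp
    | succ i ih => rw [pow_succ', map_mul, Module.End.mul_apply, ih, rep_x, pow_succ', mul_assoc]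
  have key : rep R a m = ∑ i ∈ Finset.range (n+1),
      X ^ i * rep R (aeval (Wy R) ((sym a).coeff i)) m := by
    conv_lhs => rw [ea]
    rw [map_sum, LinearMap.sum_apply]
    refine Finset.sum_congr rfl fun i _ => ?_
    rw [map_mul, Module.End.mul_apply, hx]
  rw [key]
  constructor
  · apply natDegree_sum_le_of_forall_le
    intro i hi
    have hi' : i ≤ n := by simpa [Nat.lt_succ_iff] using hi
    refine (natDegree_mul_le).trans ?_
    have := (rep_aeval_y ((sym a).coeff i) hm).1
    have := natDegree_X_pow_le (R := Polynomial R) i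
    omega
  · rw [finsetSum_coeff, Finset.sum_eq_single n]
    · rw [add_comm n d, coeff_X_pow_mul, (rep_aeval_y _ hm).2]
    · intro i hi hne
      have hi' : i < n := by
        have : i < n + 1 := by simpa using hi
        omega
      rw [show n + d = (n - i + d) + i by omega, coeff_X_pow_mul]
      apply coeff_eq_zero_of_natDegree_lt
      have := (rep_aeval_y ((sym a).coeff i) hm).1
      omega
    · simp

theorem sym_ne_zero {a : Weyl R} (h : a ≠ 0) : sym a ≠ 0 := by
  intro h0; apply h; apply sym_inj; rw [h0, sym_zero]

theorem sym_natDegree_mul [IsDomain R] {a b : Weyl R} (ha : a ≠ 0) (hb : b ≠ 0) :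
    a * b ≠ 0 ∧ (sym (a * b)).natDegree = (sym a).natDegree + (sym b).natDegree := by
  have h := rep_top a (le_refl (sym a).natDegree) (le_refl (sym b).natDegree)
  rw [← sym_mul] at h
  have hne : (sym (a * b)).coeff ((sym a).natDegree + (sym b).natDegree) ≠ 0 := by
    rw [h.2]
    exact mul_ne_zero (leadingCoeff_ne_zero.mpr (sym_ne_zero ha))
      (leadingCoeff_ne_zero.mpr (sym_ne_zero hb))
  constructor
  · rintro h0; rw [h0] at hne; simp at hne
  · exact le_antisymm h.1 (le_natDegree_of_ne_zero hne)

instance [IsDomain R] : NoZeroDivisors (Weyl R) where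
  eq_zero_or_eq_zero_of_mul_eq_zero := by
    intro a b h
    by_contra! hc
    exact (sym_natDegree_mul hc.1 hc.2).1 h

instance [Nontrivial R] : Nontrivial (Weyl R) :=
  ⟨⟨0, 1, fun h => by
    have := congrArg sym h
    simp at this⟩⟩

theorem sym_natDegree_pow [IsDomain R] {a : Weyl R} (ha : a ≠ 0) (p : ℕ) :
    (sym (a ^ p)).natDegree = p * (sym a).natDegree := by
  induction p with
  | zero => simp
  | succ p ih => rw [pow_succ, (sym_natDegree_mul (pow_ne_zero _ ha) ha).2, ih, Nat.succ_mul]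

end degrees

end Part2

section Part3

section abstractWeyl
variable {B : Type} [Ring B]

theorem ab_pow {S D : B} (h : D * S = S * D + 1) (n : ℕ) :
    D * S ^ n = S ^ n * D + (n : B) * S ^ (n - 1) := by
  induction n with
  | zero => simp
  | succ n ih =>
    rw [pow_succ, ← mul_assoc, ih, add_mul, mul_assoc _ D, h]
    rcases n with _ | n
    · simp
    · simp [pow_succ, mul_add, add_mul, mul_assoc]; abel

theorem ab_indep {k : Type} [Field k] [Algebra k B] (p : ℕ) [Fact p.Prime] [CharP k p] {S D : B}
    (h : D * S = S * D + 1) (n : ℕ) (hn : n ≤ p) (q : ℕ → B) (hq : ∀ i, D * q i = q i * D)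
    (hs : ∑ i ∈ Finset.range n, S ^ i * q i = 0) : ∀ i < n, q i = 0 := by
  induction n generalizing q with
  | zero => intro i hi; omega
  | succ n ih =>
    have h1 : ∀ i, D * (S ^ i * q i) - (S ^ i * q i) * D = (i : B) * S ^ (i - 1) * q i := by
      intro i
      rw [← mul_assoc, ab_pow h, mul_assoc (S ^ i) (q i) D, ← hq, add_mul, mul_assoc, mul_assoc]
      abel
    have h2 : ∑ i ∈ Finset.range (n+1), (i : B) * S ^ (i - 1) * q i = 0 := by
      rw [← Finset.sum_congr rfl fun i _ => h1 i, Finset.sum_sub_distrib, ← Finset.mul_sum,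
        ← Finset.sum_mul, hs]
      simp
    rw [Finset.sum_range_succ'] at h2
    have h3 : ∀ i < n, q (i + 1) = 0 := by
      intro i hi
      have := ih (by omega) (fun i => ((i + 1 : ℕ) : B) * q (i + 1)) (by
        intro i
        rw [← mul_assoc, ← (Nat.cast_commute (i+1) D).eq, mul_assoc, hq, mul_assoc]) (by
        rw [← h2]
        simp only [Nat.cast_zero, zero_mul, add_zero]
        refine Finset.sum_congr rfl fun i _ => ?_
        rw [Nat.add_sub_cancel, ← mul_assoc, (Nat.cast_commute (i+1) (S ^ i)).eq]) i hi
      have hu : ((i + 1 : ℕ) : k) ≠ 0 := by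
        intro h0
        rw [CharP.cast_eq_zero_iff k p] at h0
        exact absurd (Nat.le_of_dvd (by omega) h0) (by omega)
      rw [← map_natCast (algebraMap k B), ← Algebra.smul_def] at this
      exact (smul_eq_zero_iff_right hu).mp this
    intro i hi
    rcases i with _ | i
    · rw [Finset.sum_range_succ', Finset.sum_eq_zero] at hs
      · simpa using hs
      · intro i hi'
        rw [h3 i (by simpa using hi'), mul_zero]
    · exact h3 i (by omega)

theorem ab_indep2 {k : Type} [Field k] [Algebra k B] (p : ℕ) [Fact p.Prime] [CharP k p] {S D : B}
    (h : D * S = S * D + 1) (z : ℕ → ℕ → B) (hz : ∀ i j w, z i j * w = w * z i j)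
    (hs : ∑ i ∈ Finset.range p, ∑ j ∈ Finset.range p, z i j * (S ^ i * D ^ j) = 0) :
    ∀ i < p, ∀ j < p, z i j = 0 := by
  intro i hi j hj
  have h1 := ab_indep (k := k) p h p le_rfl (fun i => ∑ j ∈ Finset.range p, D ^ j * z i j) (by
    intro i
    rw [Finset.mul_sum, Finset.sum_mul]
    refine Finset.sum_congr rfl fun j _ => ?_
    rw [mul_assoc, hz, ← mul_assoc, ← mul_assoc, ← pow_succ', pow_succ]) (by
    rw [← hs]
    refine Finset.sum_congr rfl fun i _ => ?_
    rw [Finset.mul_sum]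
    refine Finset.sum_congr rfl fun j _ => ?_
    rw [hz, mul_assoc]) i hi
  exact ab_indep (k := k) (S := D) (D := -S) p (by rw [neg_mul, mul_neg, h]; abel) p le_rfl
    (fun j => z i j) (fun j => (hz i j _).symm) h1 j hj

end abstractWeyl

section charp
variable {k : Type} [Field k] (p : ℕ) [Fact p.Prime] [CharP k p]

theorem castp_zero : (p : Weyl k) = 0 := by
  have := map_natCast (algebraMap k (Weyl k)) p
  rw [← this, CharP.cast_eq_zero, map_zero]

theorem central_of_comm {z : Weyl k} (hx : z * Wx k = Wx k * z) (hy : z * Wy k = Wy k * z) :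
    ∀ w, z * w = w * z := by
  intro w
  induction w using W_induction with
  | h1 => simp
  | hadd a b ha hb => rw [mul_add, add_mul, ha, hb]
  | hs c a ha => rw [mul_smul_comm, smul_mul_assoc, ha]
  | hx a ha => rw [← mul_assoc, hx, mul_assoc, ha, mul_assoc]
  | hy a ha => rw [← mul_assoc, hy, mul_assoc, ha, mul_assoc]

theorem U_central (w : Weyl k) : Wx k ^ p * w = w * Wx k ^ p := by
  refine central_of_comm ?_ ?_ w
  · rw [← pow_succ, pow_succ']
  · rw [y_xpow, castp_zero]; simp

theorem V_central (w : Weyl k) : Wy k ^ p * w = w * Wy k ^ p := by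
  refine central_of_comm ?_ ?_ w
  · have := ab_pow (S := Wy k) (D := -Wx k) (by
      have e1 : Wy k * (-Wx k) = -(Wy k * Wx k) := mul_neg (Wy k) (Wx k)
      have e2 : (-Wx k) * Wy k = -(Wx k * Wy k) := neg_mul (Wx k) (Wy k)
      rw [e1, e2, W_rel]; abel) p
    have e1 : Wy k ^ p * (-Wx k) = -(Wy k ^ p * Wx k) := mul_neg (Wy k ^ p) (Wx k)
    have e2 : (-Wx k) * Wy k ^ p = -(Wx k * Wy k ^ p) := neg_mul (Wx k) (Wy k ^ p)
    rw [e1, e2, castp_zero] at this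
    have e3 : (-(Wx k * Wy k ^ p)) = (-(Wy k ^ p * Wx k)) := by simpa using this
    exact (neg_injective e3).symm
  · rw [← pow_succ, pow_succ']

theorem pow_split (i j : ℕ) : Wx k ^ i * Wy k ^ j =
    (Wx k ^ p) ^ (i / p) * (Wy k ^ p) ^ (j / p) * (Wx k ^ (i % p) * Wy k ^ (j % p)) := by
  have hV : ∀ n (w : Weyl k), (Wy k ^ p) ^ n * w = w * (Wy k ^ p) ^ n := by
    intro n w
    exact ((show Commute (Wy k ^ p) w from V_central p w).pow_left n).eq
  rw [mul_assoc, ← mul_assoc ((Wy k ^ p) ^ (j / p)), hV, mul_assoc, ← mul_assoc, ← pow_mul,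
    ← pow_mul, ← pow_add, ← pow_add, Nat.div_add_mod, Nat.div_add_mod]

theorem span_center : Submodule.span (Subring.center (Weyl k))
    (Set.range fun a : Fin p × Fin p => Wx k ^ (a.1 : ℕ) * Wy k ^ (a.2 : ℕ)) = ⊤ := by
  have hp : 0 < p := (Fact.out : p.Prime).pos
  rw [eq_top_iff]
  intro w _
  obtain ⟨N, hN⟩ := exists_tdeg (sym w)
  rw [eq_sum_of_tdeg hN]
  refine Submodule.sum_mem _ fun i _ => Submodule.sum_mem _ fun j _ => ?_
  have hc : ((sym w).coeff i).coeff j • ((Wx k ^ p) ^ (i / p) * (Wy k ^ p) ^ (j / p))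
      ∈ Subring.center (Weyl k) := by
    rw [Subring.mem_center_iff]
    intro g
    have h1 : Commute (Wx k ^ p) g := U_central p g
    have h2 : Commute (Wy k ^ p) g := V_central p g
    have := ((h1.pow_left (i/p)).mul_left (h2.pow_left (j/p))).eq
    rw [mul_smul_comm, smul_mul_assoc, this]
  have := Submodule.smul_mem (Submodule.span (Subring.center (Weyl k))
    (Set.range fun a : Fin p × Fin p => Wx k ^ (a.1 : ℕ) * Wy k ^ (a.2 : ℕ))) ⟨_, hc⟩
    (Submodule.subset_span ⟨(⟨i % p, Nat.mod_lt _ hp⟩, ⟨j % p, Nat.mod_lt _ hp⟩), rfl⟩)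
  rw [pow_split p i j, ← smul_mul_assoc]
  exact this

theorem exists_rel {S D : Weyl k} (h : D * S = S * D + 1) (w : Weyl k) :
    ∃ (z0 : Weyl k) (z : ℕ → ℕ → Weyl k), z0 ≠ 0 ∧ (∀ u, z0 * u = u * z0) ∧
      (∀ i j u, z i j * u = u * z i j) ∧
      z0 * w = ∑ i ∈ Finset.range p, ∑ j ∈ Finset.range p, z i j * (S ^ i * D ^ j) := by
  classical
  let Z := Subring.center (Weyl k)
  let v : Option (Fin p × Fin p) → Weyl k := fun o =>
    o.elim w (fun a => S ^ (a.1 : ℕ) * D ^ (a.2 : ℕ))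
  have hnl : ¬ LinearIndependent Z v := by
    intro hl
    have := linearIndependent_le_span v hl _ (span_center (k := k) p)
    rw [Cardinal.mk_fintype] at this
    have h2 := this.trans (Nat.cast_le.mpr (Fintype.card_range_le (fun a : Fin p × Fin p => Wx k ^ (a.1 : ℕ) * Wy k ^ (a.2 : ℕ))))
    simp at h2
    norm_cast at h2
    omega
  rw [Fintype.not_linearIndependent_iff] at hnl
  obtain ⟨g, hg, hne⟩ := hnl
  rw [Fintype.sum_option, Fintype.sum_prod_type] at hg
  have hcen : ∀ o, ∀ u, (g o : Weyl k) * u = u * g o := fun o u =>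
    (Subring.mem_center_iff.mp (g o).2 u).symm
  let z : ℕ → ℕ → Weyl k := fun i j =>
    if hh : i < p ∧ j < p then - (g (some (⟨i, hh.1⟩, ⟨j, hh.2⟩)) : Weyl k) else 0
  have hz : ∀ i j u, z i j * u = u * z i j := by
    intro i j u
    simp only [z]
    split_ifs with hh
    · have e1 := neg_mul (g (some (⟨i, hh.1⟩, ⟨j, hh.2⟩)) : Weyl k) u
      have e2 := mul_neg u (g (some (⟨i, hh.1⟩, ⟨j, hh.2⟩)) : Weyl k)
      rw [hcen] at e1
      exact e1.trans e2.symm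
    · simp
  have hsum : (g none : Weyl k) * w =
      ∑ i ∈ Finset.range p, ∑ j ∈ Finset.range p, z i j * (S ^ i * D ^ j) := by
    have : (g none : Weyl k) * w + ∑ i : Fin p, ∑ j : Fin p,
      (g (some (i, j)) : Weyl k) * (S ^ (i : ℕ) * D ^ (j : ℕ)) = 0 := hg
    rw [eq_neg_of_add_eq_zero_left this, ← Finset.sum_neg_distrib, Finset.sum_range]
    refine Finset.sum_congr rfl fun i _ => ?_
    rw [← Finset.sum_neg_distrib, Finset.sum_range]
    refine Finset.sum_congr rfl fun j _ => ?_
    simp only [z, i.2, j.2, and_self, dite_true]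
    exact (neg_mul (g (some (i, j)) : Weyl k) (S ^ (i : ℕ) * D ^ (j : ℕ))).symm
  refine ⟨g none, z, ?_, hcen none, hz, hsum⟩
  intro h0
  rw [h0, zero_mul] at hsum
  have hz0 := ab_indep2 (k := k) p h z hz hsum.symm
  obtain ⟨o, ho⟩ := hne
  apply ho
  apply Subtype.ext
  rcases o with _ | ⟨i, j⟩
  · exact h0
  · have := hz0 i i.2 j j.2
    simp only [z, i.2, j.2, and_self, dite_true] at this
    exact neg_eq_zero.mp this

theorem pow_p_central (p : ℕ) [Fact p.Prime] [CharP k p] {S D c : Weyl k} (h : D * S = S * D + 1) (hS : Commute c S)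
    (hD : Commute c D) (w : Weyl k) : c * w = w * c := by
  obtain ⟨z0, z, hz0, hc0, hc, he⟩ := exists_rel p h w
  have h1 : c * (z0 * w) = (z0 * w) * c := by
    rw [he, Finset.mul_sum, Finset.sum_mul]
    refine Finset.sum_congr rfl fun i _ => ?_
    rw [Finset.mul_sum, Finset.sum_mul]
    refine Finset.sum_congr rfl fun j _ => ?_
    rw [← mul_assoc, ← hc, mul_assoc, mul_assoc (z i j),
      ((hS.pow_right i).mul_right (hD.pow_right j)).eq]
  rw [← mul_assoc, ← hc0, mul_assoc, mul_assoc] at h1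
  have h2 : z0 * (c * w - w * c) = 0 := by
    have := mul_sub z0 (c * w) (w * c)
    rw [this, h1, sub_self]
  have := (mul_eq_zero.mp h2).resolve_left hz0
  exact sub_eq_zero.mp this

theorem S_pow_central {S D : Weyl k} (h : D * S = S * D + 1) (w : Weyl k) :
    S ^ p * w = w * S ^ p := by
  refine pow_p_central p h ((Commute.refl S).pow_left p) ?_ w
  have := ab_pow h p
  rw [castp_zero] at this
  exact Eq.symm (by simpa using this)

theorem D_pow_central {S D : Weyl k} (h : D * S = S * D + 1) (w : Weyl k) :
    D ^ p * w = w * D ^ p := by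
  refine pow_p_central p h ?_ ((Commute.refl D).pow_left p) w
  have := ab_pow (S := D) (D := -S) (by
      have e1 : D * (-S) = -(D * S) := mul_neg D S
      have e2 : (-S) * D = -(S * D) := neg_mul S D
      rw [e1, e2, h]; abel) p
  have e1 : D ^ p * (-S) = -(D ^ p * S) := mul_neg (D ^ p) S
  have e2 : (-S) * D ^ p = -(S * D ^ p) := neg_mul S (D ^ p)
  rw [e1, e2, castp_zero] at this
  have e3 : (-(S * D ^ p)) = (-(D ^ p * S)) := by simpa using this
  exact (neg_injective e3).symm

theorem central_coeff {z : Weyl k} (hz : ∀ w, z * w = w * z) {i j : ℕ}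
    (h : ((sym z).coeff i).coeff j ≠ 0) : p ∣ i ∧ p ∣ j := by
  constructor
  · have h1 := sym_ady z
    rw [hz, sub_self, sym_zero] at h1
    rcases i with _ | i
    · simp
    have h2 := congrArg (fun m : PP k => (m.coeff i).coeff j) h1
    have e : ((i : k[X]) + 1) = ((i + 1 : ℕ) : k[X]) := by push_cast; rfl
    simp only [coeff_derivative, e, coeff_mul_natCast, coeff_zero] at h2
    have := (mul_eq_zero.mp h2.symm).resolve_left h
    rwa [CharP.cast_eq_zero_iff k p] at this
  · have h1 := sym_adx z i
    rw [hz, sub_self, sym_zero] at h1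
    rcases j with _ | j
    · simp
    have h2 := congrArg (fun m : k[X] => m.coeff j) h1
    simp only [coeff_derivative, coeff_zero] at h2
    have := (mul_eq_zero.mp h2.symm).resolve_left h
    have e : ((j : k) + 1) = ((j + 1 : ℕ) : k) := by push_cast; rfl
    rwa [e, CharP.cast_eq_zero_iff k p] at this

end charp

end Part3

section Part4

section abstractBracket
variable {B : Type} [Ring B]

theorem ab_bracket {S D : B} (h : D * S = S * D + 1) (p : ℕ) (hp : p.Prime)
    (hp2 : (p : B) * p = 0) :
    D ^ p * S ^ p = S ^ p * D ^ p + (p : B) * ((p - 1).factorial : B) := by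
  let L := LinearMap.mulLeft ℤ D
  let Rr := LinearMap.mulRight ℤ D
  let ad : Module.End ℤ B := L - Rr
  have hLR : Commute L Rr := LinearMap.commute_mulLeft_right (R := ℤ) D D
  have hadR : Commute ad Rr := hLR.sub_left (Commute.refl Rr)
  have hL : L = ad + Rr := by simp [ad]
  have hexp := hadR.add_pow p
  rw [← hL] at hexp
  have hLp : (L ^ p) (S ^ p) = D ^ p * S ^ p := by
    simp only [L, LinearMap.pow_mulLeft, LinearMap.mulLeft_apply]
  have hRp : ∀ m w, (Rr ^ m) w = w * D ^ m := by
    intro m w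
    simp only [Rr, LinearMap.pow_mulRight, LinearMap.mulRight_apply]
  have had : ∀ m, (ad ^ m) (S ^ p) = ((p.descFactorial m : ℕ) : B) * S ^ (p - m) := by
    intro m
    induction m with
    | zero => simp
    | succ m ih =>
      rw [pow_succ', Module.End.mul_apply, ih]
      simp only [ad, L, Rr, LinearMap.sub_apply, LinearMap.mulLeft_apply, LinearMap.mulRight_apply]
      rw [← mul_assoc, ← (Nat.cast_commute (p.descFactorial m) D).eq, mul_assoc, ab_pow h,
        Nat.descFactorial_succ, mul_comm (p - m), Nat.cast_mul, mul_add, Nat.sub_sub]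
      simp only [mul_assoc]
      abel
  have hterm : ∀ m, (ad ^ m * Rr ^ (p - m) * ((p.choose m : ℕ) : Module.End ℤ B)) (S ^ p)
      = ((p.choose m * p.descFactorial m : ℕ) : B) * (S ^ (p - m) * D ^ (p - m)) := by
    intro m
    rw [(hadR.pow_pow m (p - m)).eq, (Nat.cast_commute (p.choose m) _).symm.eq,
      Module.End.mul_apply, Module.End.mul_apply, had, hRp, Module.End.natCast_apply,
      nsmul_eq_mul, Nat.cast_mul]
    simp only [mul_assoc]
  rw [← hLp, hexp, LinearMap.sum_apply, Finset.sum_congr rfl fun m _ => hterm m]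
  obtain ⟨q, rfl⟩ : ∃ q, p = q + 1 := ⟨p - 1, by have := hp.pos; omega⟩
  rw [Finset.sum_range_succ, Finset.sum_range_succ', Finset.sum_eq_zero]
  · simp only [Nat.choose_zero_right, Nat.descFactorial_zero, Nat.choose_self,
      Nat.descFactorial_self, Nat.sub_zero, Nat.sub_self, Nat.factorial_succ, Nat.add_sub_cancel]
    simp
  · intro m hm
    have hm' : m < q := by simpa using hm
    obtain ⟨a, ha⟩ := hp.dvd_choose_self (k := m + 1) (by omega) (by omega)
    have hb' : (q + 1) ∣ (q+1).descFactorial (m+1) := by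
      rw [Nat.succ_descFactorial_succ]; exact Dvd.intro _ rfl
    obtain ⟨b, hb⟩ := hb'
    have : (((q+1).choose (m+1) * (q+1).descFactorial (m+1) : ℕ) : B) = 0 := by
      rw [ha, hb, show (q+1) * a * ((q+1) * b) = (q+1) * (q+1) * (a * b) by ring, Nat.cast_mul,
        Nat.cast_mul, hp2, zero_mul]
    rw [this, zero_mul]

theorem ab_VU {U V e : B} (h : V * U = U * V + e) (he : ∀ w, e * w = w * e) (he2 : e * e = 0)
    (l i : ℕ) : V ^ l * U ^ i = U ^ i * V ^ l + ((l * i : ℕ) : B) * e * (U ^ (i-1) * V ^ (l-1)) := by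
  have h1 : ∀ i : ℕ, V * U ^ i = U ^ i * V + (i : B) * e * U ^ (i-1) := by
    intro i
    induction i with
    | zero => simp
    | succ n ih =>
      rw [pow_succ, ← mul_assoc, ih, add_mul, mul_assoc _ V, h]
      rcases n with _ | n
      · simp
      · have : U ^ n * (U * e) = e * (U ^ n * U) := by
          rw [← he U, ← mul_assoc, ← he, mul_assoc]
        simp [pow_succ, mul_add, add_mul, mul_assoc, this]; abel
  have h2 : ∀ l i : ℕ, e * (V ^ l * U ^ i) = e * (U ^ i * V ^ l) := by
    have h3 : ∀ i : ℕ, e * (V * U ^ i) = e * (U ^ i * V) := by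
      intro i
      rw [h1, mul_add, ← mul_assoc, ← mul_assoc e, ← mul_assoc e, ← (Nat.cast_commute i e).eq,
        mul_assoc _ e e, he2]
      simp [mul_assoc]
    intro l i
    induction l with
    | zero => simp
    | succ l ih =>
      rw [pow_succ', mul_assoc, ← mul_assoc, he, mul_assoc, ih, ← mul_assoc, ← he, mul_assoc,
        ← mul_assoc V, ← mul_assoc, h3]
      simp only [mul_assoc]
  induction l with
  | zero => simp
  | succ l ih =>
    have h4 : V ^ l * ((i : B) * e * U ^ (i-1)) = (i : B) * (e * (U ^ (i-1) * V ^ l)) := by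
      rw [← h2, mul_assoc, ← mul_assoc, ← (Nat.cast_commute i _).eq, mul_assoc, ← mul_assoc (V ^ l),
        ← he]
      simp only [mul_assoc]
    rw [pow_succ, mul_assoc, h1, mul_add, ← mul_assoc, ih, h4]
    rcases l with _ | l
    · simp [mul_assoc]
    · simp only [Nat.add_sub_cancel, pow_succ, mul_assoc, add_mul]
      push_cast
      simp only [mul_assoc, add_mul, mul_add, one_mul]
      abel

theorem ab_mono_bracket {U V e : B} (h : V * U = U * V + e) (he : ∀ w, e * w = w * e)
    (he2 : e * e = 0) (i j k l : ℕ) :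
    (U ^ k * V ^ l) * (U ^ i * V ^ j) - (U ^ i * V ^ j) * (U ^ k * V ^ l) =
    e * (((l * i : ℕ) : B) - ((k * j : ℕ) : B)) * (U ^ (i + k - 1) * V ^ (j + l - 1)) := by
  have h1 : ∀ i j k l : ℕ, (U ^ k * V ^ l) * (U ^ i * V ^ j) = U ^ (k + i) * V ^ (l + j) +
      e * ((l * i : ℕ) : B) * (U ^ (i + k - 1) * V ^ (j + l - 1)) := by
    intro i j k l
    rw [mul_assoc, ← mul_assoc (V ^ l), ab_VU h he he2, add_mul, mul_add, pow_add, pow_add]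
    simp only [mul_assoc]
    congr 1
    rcases i with _ | i
    · simp
    rcases l with _ | l
    · simp
    rw [show i + 1 + k - 1 = k + i by omega, show j + (l + 1) - 1 = l + j by omega, pow_add,
      pow_add, Nat.add_sub_cancel, Nat.add_sub_cancel]
    have e1 : ∀ w, U ^ k * (e * w) = e * (U ^ k * w) := by
      intro w; rw [← mul_assoc, ← he, mul_assoc]
    have e2 : ∀ w, U ^ k * (((l + 1) * (i + 1) : ℕ) * w) = ((l + 1) * (i + 1) : ℕ) * (U ^ k * w) := by
      intro w; rw [← mul_assoc, ← (Nat.cast_commute _ (U ^ k)).eq, mul_assoc]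
    have e3 : ∀ w, e * (((l + 1) * (i + 1) : ℕ) * w) = ((l + 1) * (i + 1) : ℕ) * (e * w) := by
      intro w; rw [← mul_assoc, ← (Nat.cast_commute _ e).eq, mul_assoc]
    simp only [mul_assoc, e1, e2, e3]
  rw [h1, h1 k l i j, add_comm i k, add_comm j l, mul_sub, sub_mul, mul_comm k j]
  abel

end abstractBracket

end Part4

section Part5

theorem ab_mod {B : Type} [Ring B] {P Bs Cs E1 E2 F1 F2 : B} (hP : ∀ w, P * w = w * P)
    (hP2 : P * P = 0) (h1 : E2 * Cs - Cs * E2 = P * F1) (h2 : Bs * E1 - E1 * Bs = P * F2) :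
    (Bs + P * E2) * (Cs + P * E1) - (Cs + P * E1) * (Bs + P * E2) = Bs * Cs - Cs * Bs := by
  have e1 : ∀ a b, a * (P * b) = P * (a * b) := by
    intro a b; rw [← mul_assoc, ← hP, mul_assoc]
  have e2 : ∀ w, P * (P * w) = 0 := by intro w; rw [← mul_assoc, hP2, zero_mul]
  have : (Bs + P * E2) * (Cs + P * E1) - (Cs + P * E1) * (Bs + P * E2) = Bs * Cs - Cs * Bs
      + P * (E2 * Cs - Cs * E2) + P * (Bs * E1 - E1 * Bs) := by
    simp only [add_mul, mul_add, mul_sub, mul_assoc, e1, e2]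
    abel
  rw [this, h1, h2, e2, e2]; simp

section lift
variable {A k : Type} [CommRing A] [Field k] (p : ℕ) [Fact p.Prime] [CharP k p] (π : A →+* k)

theorem natCast_mul_W {R : Type} [CommRing R] (n : ℕ) (w : Weyl R) :
    (n : Weyl R) * w = (n : R) • w := by
  rw [Algebra.smul_def, map_natCast]

theorem lift_L1 (h : ∀ a, π a = 0 → ∃ b, a = p * b) {w : Weyl A} (hw : wmap π w = 0) :
    ∃ E, w = (p : Weyl A) * E := by
  have hg : ∀ a, ∃ b, π a = 0 → a = p * b := by
    intro a
    by_cases ha : π a = 0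
    · obtain ⟨b, hb⟩ := h a ha; exact ⟨b, fun _ => hb⟩
    · exact ⟨0, fun h => absurd h ha⟩
  choose g hg using hg
  obtain ⟨N, hN⟩ := exists_tdeg (sym w)
  refine ⟨∑ i ∈ Finset.range (N+1), ∑ j ∈ Finset.range (N+1),
    g (((sym w).coeff i).coeff j) • (Wx A ^ i * Wy A ^ j), ?_⟩
  conv_lhs => rw [eq_sum_of_tdeg hN]
  rw [Finset.mul_sum]
  refine Finset.sum_congr rfl fun i _ => ?_
  rw [Finset.mul_sum]
  refine Finset.sum_congr rfl fun j _ => ?_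
  rw [natCast_mul_W, smul_smul, ← hg]
  rw [← coeff_wmap, hw]; simp

theorem lift_L2 (h : ∀ a, (p : A) * a = 0 → π a = 0) {E : Weyl A} (hE : (p : Weyl A) * E = 0) :
    wmap π E = 0 := by
  apply sym_inj
  ext i j
  rw [coeff_wmap]
  simp only [sym_zero, coeff_zero]
  apply h
  rw [natCast_mul_W] at hE
  have := congrArg (fun w => ((sym w).coeff i).coeff j) hE
  simpa using this

theorem wmap_L3 {w : Weyl A} (E : Weyl A) (h : w = (p : Weyl A) * E) : wmap π w = 0 := by
  rw [h, map_mul, map_natCast, castp_zero, zero_mul]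

/-- coefficient at the lattice point -/
def pc {R : Type} [CommRing R] (p : ℕ) (w : Weyl R) (a : ℕ × ℕ) : R :=
  ((sym w).coeff (p * a.1)).coeff (p * a.2)

def bx (n : ℕ) : Finset (ℕ × ℕ) := Finset.range (n+1) ×ˢ Finset.range (n+1)

theorem central_eq {z : Weyl k} (hz : ∀ w, z * w = w * z) {n : ℕ} (hn : tdeg (p * n) (sym z)) :
    z = ∑ a ∈ bx n, pc p z a • ((Wx k ^ p) ^ a.1 * (Wy k ^ p) ^ a.2) := by
  have hp : 0 < p := (Fact.out : p.Prime).pos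
  apply sym_inj
  ext i j
  simp only [sym_sum, sym_smul, finsetSum_coeff, coeff_smul, ← pow_mul, coeff_sym_xy]
  by_cases h : ((sym z).coeff i).coeff j = 0
  · rw [h, Finset.sum_eq_zero]
    intro a _
    split_ifs with h1
    · rw [pc, h1.1, h1.2, h]; simp
    · simp
  · obtain ⟨⟨i, rfl⟩, ⟨j, rfl⟩⟩ := central_coeff p hz h
    have hle : ¬ (p * n < p * i + p * j) := fun h' => h (hn _ _ h')
    have hle2 : i + j ≤ n := by
      rw [← mul_add] at hle
      exact le_of_mul_le_mul_left (not_lt.mp hle) hp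
    rw [Finset.sum_eq_single (i, j)]
    · simp [pc]
    · rintro ⟨a, b⟩ _ hne
      have : ¬ (p * a = p * i ∧ p * b = p * j) := by
        rintro ⟨h1, h2⟩
        apply hne
        rw [Nat.eq_of_mul_eq_mul_left hp h1, Nat.eq_of_mul_eq_mul_left hp h2]
      simp only [this, if_false, smul_zero]
    · intro hc
      exfalso; apply hc
      simp [bx]; omega

theorem pc_wmap (w : Weyl A) (a : ℕ × ℕ) : pc p (wmap π w) a = π (pc p w a) := coeff_wmap _ _ _ _

theorem bracket_identity (hp2 : (p : A) * p = 0) (hk1 : ∀ a, π a = 0 → ∃ b, a = p * b)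
    (hk2 : ∀ a, (p : A) * a = 0 → π a = 0) {S D : Weyl A} (h : D * S = S * D + 1) {n : ℕ}
    (hS : tdeg n (sym (wmap π S))) (hD : tdeg n (sym (wmap π D))) :
    ∑ b ∈ bx n, ∑ a ∈ bx n, (pc p (wmap π D ^ p) b * pc p (wmap π S ^ p) a *
      ((b.2 * a.1 : ℕ) - (b.1 * a.2 : ℕ) : k)) •
      (Wx k ^ (p * (a.1 + b.1 - 1)) * Wy k ^ (p * (a.2 + b.2 - 1))) = 1 := by
  have hpW : (p : Weyl A) * p = 0 := by
    rw [natCast_mul_W]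
    have : (p : Weyl A) = (p : A) • 1 := by rw [← natCast_mul_W, mul_one]
    rw [this, smul_smul, hp2, zero_smul]
  have hk : wmap π D * wmap π S = wmap π S * wmap π D + 1 := by
    rw [← map_mul, h, map_add, map_mul, map_one]
  let U := Wx A ^ p
  let V := Wy A ^ p
  let mon : ℕ × ℕ → Weyl A := fun a => U ^ a.1 * V ^ a.2
  let Bs := ∑ b ∈ bx n, pc p (D ^ p) b • mon b
  let Cs := ∑ a ∈ bx n, pc p (S ^ p) a • mon a
  have hmon : ∀ a, wmap π (mon a) = (Wx k ^ p) ^ a.1 * (Wy k ^ p) ^ a.2 := by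
    intro a; simp [mon, U, V]
  have hCs : wmap π Cs = wmap π S ^ p := by
    conv_rhs => rw [central_eq p (S_pow_central p hk) (tdeg_pow hS p)]
    rw [map_sum]
    refine Finset.sum_congr rfl fun a _ => ?_
    rw [wmap_smul, hmon, ← pc_wmap, map_pow]
  have hBs : wmap π Bs = wmap π D ^ p := by
    conv_rhs => rw [central_eq p (D_pow_central p hk) (tdeg_pow hD p)]
    rw [map_sum]
    refine Finset.sum_congr rfl fun a _ => ?_
    rw [wmap_smul, hmon, ← pc_wmap, map_pow]
  obtain ⟨E1, hE1⟩ := lift_L1 p π hk1 (w := S ^ p - Cs) (by rw [map_sub, hCs, map_pow, sub_self])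
  obtain ⟨E2, hE2⟩ := lift_L1 p π hk1 (w := D ^ p - Bs) (by rw [map_sub, hBs, map_pow, sub_self])
  obtain ⟨F1, hF1⟩ := lift_L1 p π hk1 (w := E2 * Cs - Cs * E2) (by
    rw [map_sub, map_mul, map_mul, hCs, S_pow_central p hk, sub_self])
  obtain ⟨F2, hF2⟩ := lift_L1 p π hk1 (w := Bs * E1 - E1 * Bs) (by
    rw [map_sub, map_mul, map_mul, hBs, D_pow_central p hk, sub_self])
  have hmod := ab_mod (P := (p : Weyl A)) (fun w => (Nat.cast_commute p w).eq) hpW hF1 hF2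
  have hS' : Cs + (p : Weyl A) * E1 = S ^ p := by rw [← hE1]; exact add_sub_cancel Cs (S ^ p)
  have hD' : Bs + (p : Weyl A) * E2 = D ^ p := by rw [← hE2]; exact add_sub_cancel Bs (D ^ p)
  rw [hS', hD'] at hmod
  have hbr := ab_bracket h p Fact.out hpW
  have hUV := ab_bracket (W_rel A) p Fact.out hpW
  let c0 : Weyl A := ((p - 1).factorial : Weyl A)
  have hlhs : D ^ p * S ^ p - S ^ p * D ^ p = (p : Weyl A) * c0 := by
    rw [hbr]; exact add_sub_cancel_left (S ^ p * D ^ p) _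
  have hec : ∀ w, ((p : Weyl A) * c0) * w = w * ((p : Weyl A) * c0) := fun w =>
    ((Nat.cast_commute p w).mul_left (Nat.cast_commute _ w)).eq
  have he2 : ((p : Weyl A) * c0) * ((p : Weyl A) * c0) = 0 := by
    rw [mul_assoc, ← mul_assoc c0, ← (Nat.cast_commute p c0).eq, mul_assoc, ← mul_assoc, hpW,
      zero_mul]
  have hmb := fun a b : ℕ × ℕ => ab_mono_bracket hUV hec he2 a.1 a.2 b.1 b.2
  let T : Weyl A := ∑ b ∈ bx n, ∑ a ∈ bx n, (pc p (D ^ p) b * pc p (S ^ p) a *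
      ((b.2 * a.1 : ℕ) - (b.1 * a.2 : ℕ) : A)) • (U ^ (a.1 + b.1 - 1) * V ^ (a.2 + b.2 - 1))
  have hBC : Bs * Cs - Cs * Bs = (p : Weyl A) * (c0 * T) := by
    have e1 : Bs * Cs = ∑ b ∈ bx n, ∑ a ∈ bx n,
        (pc p (D ^ p) b * pc p (S ^ p) a) • (mon b * mon a) := by
      rw [Finset.sum_mul_sum]
      refine Finset.sum_congr rfl fun b _ => Finset.sum_congr rfl fun a _ => ?_
      rw [smul_mul_smul_comm]
    have e2 : Cs * Bs = ∑ b ∈ bx n, ∑ a ∈ bx n,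
        (pc p (D ^ p) b * pc p (S ^ p) a) • (mon a * mon b) := by
      rw [Finset.sum_mul_sum, Finset.sum_comm]
      refine Finset.sum_congr rfl fun b _ => Finset.sum_congr rfl fun a _ => ?_
      rw [smul_mul_smul_comm, mul_comm (pc p (S ^ p) a)]
    rw [e1, e2, ← Finset.sum_sub_distrib, ← mul_assoc, Finset.mul_sum]
    refine Finset.sum_congr rfl fun b _ => ?_
    rw [← Finset.sum_sub_distrib, Finset.mul_sum]
    refine Finset.sum_congr rfl fun a _ => ?_
    have e3 := smul_sub (pc p (D ^ p) b * pc p (S ^ p) a) (mon b * mon a) (mon a * mon b)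
    refine e3.symm.trans ?_
    have hm : mon b * mon a - mon a * mon b = (p : Weyl A) * c0 *
      (((b.2 * a.1 : ℕ) : Weyl A) - ((b.1 * a.2 : ℕ) : Weyl A)) *
        (U ^ (a.1 + b.1 - 1) * V ^ (a.2 + b.2 - 1)) := hmb a b
    have e4 : (((b.2 * a.1 : ℕ) : Weyl A) - ((b.1 * a.2 : ℕ) : Weyl A)) =
      ((b.2 * a.1 : ℕ) - (b.1 * a.2 : ℕ) : A) • (1 : Weyl A) := by
      have e5 := sub_smul ((b.2 * a.1 : ℕ) : A) ((b.1 * a.2 : ℕ) : A) (1 : Weyl A)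
      rw [← natCast_mul_W, ← natCast_mul_W, mul_one, mul_one] at e5
      exact e5.symm
    rw [hm, e4, mul_smul_comm, smul_mul_assoc, mul_one, smul_smul, mul_smul_comm]
  have hfin : (p : Weyl A) * (c0 * (1 - T)) = 0 := by
    have e : c0 * (1 - T) = c0 - c0 * T := by
      have := mul_sub c0 1 T
      rw [mul_one] at this
      exact this
    rw [e]
    have := mul_sub (p : Weyl A) c0 (c0 * T)
    rw [this, ← hBC, ← hlhs, hmod]
    exact sub_self _
  have h0 := lift_L2 p π hk2 hfin
  rw [map_mul] at h0
  have hc0 : wmap π c0 ≠ 0 := by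
    simp only [c0, map_natCast]
    intro h0
    have h1 : ((((p - 1).factorial : ℕ) : k) • (1 : Weyl k)) = 0 := by
      rw [← natCast_mul_W, mul_one, h0]
    have h2 := (smul_eq_zero.mp h1).resolve_right one_ne_zero
    rw [CharP.cast_eq_zero_iff k p, (Fact.out : p.Prime).dvd_factorial] at h2
    have := (Fact.out : p.Prime).pos
    omega
  have hT := (mul_eq_zero.mp h0).resolve_left hc0
  rw [map_sub, map_one, sub_eq_zero] at hT
  rw [hT]
  simp only [T, map_sum, wmap_smul, map_mul, map_sub, map_natCast, ← pc_wmap, map_pow, U, V,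
    wmap_x, wmap_y, pow_mul]

theorem bracket_coeff (hp2 : (p : A) * p = 0) (hk1 : ∀ a, π a = 0 → ∃ b, a = p * b)
    (hk2 : ∀ a, (p : A) * a = 0 → π a = 0) {S D : Weyl A} (h : D * S = S * D + 1) {n : ℕ}
    (hS : tdeg n (sym (wmap π S))) (hD : tdeg n (sym (wmap π D))) (u v : ℕ) :
    ∑ b ∈ bx n, ∑ a ∈ bx n, (if a.1 + b.1 = u + 1 ∧ a.2 + b.2 = v + 1 then
      (pc p (wmap π D ^ p) b * pc p (wmap π S ^ p) a *
      ((b.2 * a.1 : ℕ) - (b.1 * a.2 : ℕ) : k)) else 0) = if u = 0 ∧ v = 0 then 1 else 0 := by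
  have hp : 0 < p := (Fact.out : p.Prime).pos
  have hb := bracket_identity p π hp2 hk1 hk2 h hS hD
  have := congrArg (fun w => ((sym w).coeff (p * u)).coeff (p * v)) hb
  simp only [sym_sum, sym_smul, finsetSum_coeff, coeff_smul, coeff_sym_xy] at this
  have e1 : ((sym (1 : Weyl k)).coeff (p * u)).coeff (p * v) = if u = 0 ∧ v = 0 then 1 else 0 := by
    have := coeff_sym_xy (R := k) 0 0 (p * u) (p * v)
    simp only [pow_zero, mul_one] at this
    rw [this]
    congr 1
    simp [hp.ne', eq_comm]
  rw [e1] at this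
  rw [← this]
  refine Finset.sum_congr rfl fun b _ => Finset.sum_congr rfl fun a _ => ?_
  by_cases h1 : a.1 + b.1 = 0
  · have : a.1 = 0 := by omega
    have : b.1 = 0 := by omega
    simp [*]
  by_cases h2 : a.2 + b.2 = 0
  · have : a.2 = 0 := by omega
    have : b.2 = 0 := by omega
    simp [*]
  have e2 : (p * (a.1 + b.1 - 1) = p * u ∧ p * (a.2 + b.2 - 1) = p * v) ↔
      (a.1 + b.1 = u + 1 ∧ a.2 + b.2 = v + 1) := by
    rw [Nat.mul_right_inj hp.ne', Nat.mul_right_inj hp.ne']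
    omega
  simp only [e2]
  split_ifs <;> simp

end lift

end Part5

section Part6

section comb
variable {k : Type} [Field k] (p : ℕ) [Fact p.Prime] [CharP k p] {n : ℕ} {c b : ℕ × ℕ → k}

theorem ext_pair (hn : n * n < p)
    (hc : ∀ x, c x ≠ 0 → x.1 ≤ n ∧ x.2 ≤ n) (hb : ∀ x, b x ≠ 0 → x.1 ≤ n ∧ x.2 ≤ n)
    (H : ∀ u v, ∑ y ∈ bx n, ∑ x ∈ bx n, (if x.1 + y.1 = u + 1 ∧ x.2 + y.2 = v + 1 then
      (b y * c x * ((y.2 * x.1 : ℕ) - (y.1 * x.2 : ℕ) : k)) else 0)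
        = if u = 0 ∧ v = 0 then 1 else 0)
    {x y : ℕ × ℕ} (hx : c x ≠ 0) (hy : b y ≠ 0)
    (huniq : ∀ x' y', c x' ≠ 0 → b y' ≠ 0 → x'.1 + y'.1 = x.1 + y.1 → x'.2 + y'.2 = x.2 + y.2 →
      x' = x ∧ y' = y) (hdet : y.2 * x.1 ≠ y.1 * x.2) :
    x.1 + y.1 = 1 ∧ x.2 + y.2 = 1 := by
  have hxn := hc x hx
  have hyn := hb y hy
  have h1 : x.1 + y.1 ≠ 0 := by
    intro h0
    apply hdet
    have e1 : x.1 = 0 := by omega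
    have e2 : y.1 = 0 := by omega
    rw [e1, e2]; simp
  have h2 : x.2 + y.2 ≠ 0 := by
    intro h0
    apply hdet
    have e1 : x.2 = 0 := by omega
    have e2 : y.2 = 0 := by omega
    rw [e1, e2]; simp
  obtain ⟨u, hu⟩ := Nat.exists_eq_succ_of_ne_zero h1
  obtain ⟨v, hv⟩ := Nat.exists_eq_succ_of_ne_zero h2
  have hdk : ((y.2 * x.1 : ℕ) - (y.1 * x.2 : ℕ) : k) ≠ 0 := by
    rw [sub_ne_zero]
    intro he
    apply hdet
    refine CharP.natCast_injOn_Iio k p ?_ ?_ he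
    · exact lt_of_le_of_lt (Nat.mul_le_mul hyn.2 hxn.1) hn
    · exact lt_of_le_of_lt (Nat.mul_le_mul hyn.1 hxn.2) hn
  have hH := H u v
  have hyb : y ∈ bx n := by simp [bx]; omega
  have hxb : x ∈ bx n := by simp [bx]; omega
  rw [Finset.sum_eq_single_of_mem y hyb, Finset.sum_eq_single_of_mem x hxb, if_pos ⟨hu, hv⟩] at hH
  · have hne : b y * c x * ((y.2 * x.1 : ℕ) - (y.1 * x.2 : ℕ) : k) ≠ 0 :=
      mul_ne_zero (mul_ne_zero hy hx) hdk
    split_ifs at hH with h0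
    · omega
    · exact absurd hH hne
  · intro x' _ hne
    split_ifs with h0
    · by_cases hcx : c x' = 0
      · simp [hcx]
      · exact absurd (huniq x' y hcx hy (by omega) (by omega)).1 hne
    · rfl
  · intro y' _ hne
    refine Finset.sum_eq_zero fun x' _ => ?_
    split_ifs with h0
    · by_cases hcx : c x' = 0
      · simp [hcx]
      by_cases hby : b y' = 0
      · simp [hby]
      · exact absurd (huniq x' y' hcx hby (by omega) (by omega)).2 hne
    · rfl

theorem comb_main (hn : n * n < p)
    (hc : ∀ x, c x ≠ 0 → x.1 ≤ n ∧ x.2 ≤ n) (hb : ∀ x, b x ≠ 0 → x.1 ≤ n ∧ x.2 ≤ n)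
    (H : ∀ u v, ∑ y ∈ bx n, ∑ x ∈ bx n, (if x.1 + y.1 = u + 1 ∧ x.2 + y.2 = v + 1 then
      (b y * c x * ((y.2 * x.1 : ℕ) - (y.1 * x.2 : ℕ) : k)) else 0)
        = if u = 0 ∧ v = 0 then 1 else 0)
    (hce : ∀ x, c x ≠ 0 → Even x.2) (hbo : ∀ x, b x ≠ 0 → Odd x.2) :
    ∀ y, b y ≠ 0 → y = (0, 1) := by
  classical
  let Sc := (bx n).filter fun x => c x ≠ 0
  let Sb := (bx n).filter fun x => b x ≠ 0
  have mSc : ∀ x, x ∈ Sc ↔ c x ≠ 0 := by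
    intro x
    simp only [Sc, Finset.mem_filter, and_iff_right_iff_imp]
    intro h; have := hc x h; simp [bx]; omega
  have mSb : ∀ x, x ∈ Sb ↔ b x ≠ 0 := by
    intro x
    simp only [Sb, Finset.mem_filter, and_iff_right_iff_imp]
    intro h; have := hb x h; simp [bx]; omega
  have EP := fun x y => @ext_pair k _ p _ _ n c b hn hc hb H x y
  -- step 0
  have h0 : c (1, 0) ≠ 0 ∧ b (0, 1) ≠ 0 := by
    have h := H 0 0
    rw [if_pos ⟨rfl, rfl⟩] at h
    obtain ⟨⟨y1, y2⟩, _, hy⟩ := Finset.exists_ne_zero_of_sum_ne_zero (h ▸ one_ne_zero)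
    obtain ⟨⟨x1, x2⟩, _, hx⟩ := Finset.exists_ne_zero_of_sum_ne_zero hy
    simp only at hx
    split_ifs at hx with hs
    · have hcx : c (x1, x2) ≠ 0 := by intro h; simp [h] at hx
      have hby : b (y1, y2) ≠ 0 := by intro h; simp [h] at hx
      have e1 : Even x2 := hce _ hcx
      have e2 : Odd y2 := hbo _ hby
      obtain ⟨m1, rfl⟩ := e1
      obtain ⟨m2, rfl⟩ := e2
      have : m1 = 0 := by omega
      have : m2 = 0 := by omega
      subst m1; subst m2
      have hx1 : x1 ≠ 0 := by
        rintro rfl; simp at hx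
      have : x1 = 1 := by omega
      have : y1 = 0 := by omega
      subst x1; subst y1
      exact ⟨hcx, hby⟩
    · exact absurd rfl hx
  obtain ⟨hc10, hb01⟩ := h0
  -- step 1
  have h1 : (∀ i, c (i, 0) ≠ 0 → i ≤ 1) ∧ (∀ i, b (i, 1) ≠ 0 → i = 0) := by
    obtain ⟨⟨i0, j0⟩, hx0, hxm⟩ := Finset.exists_max_image (Sc.filter fun x => x.2 = 0) (fun x => x.1)
      ⟨(1, 0), by simp [mSc, hc10]⟩
    obtain ⟨⟨k0, l0⟩, hy0, hym⟩ := Finset.exists_max_image (Sb.filter fun x => x.2 = 1) (fun x => x.1)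
      ⟨(0, 1), by simp [mSb, hb01]⟩
    simp only [Finset.mem_filter, mSc, mSb] at hx0 hxm hy0 hym
    obtain ⟨hx0, rfl⟩ := hx0
    obtain ⟨hy0, rfl⟩ := hy0
    have hi := hxm (1, 0) ⟨hc10, rfl⟩
    simp only at hi
    have := EP (i0, 0) (k0, 1) hx0 hy0 (by
      rintro ⟨i, j⟩ ⟨k', l⟩ hcx hby e1 e2
      simp only at e1 e2
      obtain ⟨m, hm⟩ := hce _ hcx
      obtain ⟨m', hm'⟩ := hbo _ hby
      simp only at hm hm'
      have hj : j = 0 := by omega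
      have hl : l = 1 := by omega
      clear hm hm'
      subst j; subst l
      have a1 := hxm _ ⟨hcx, rfl⟩
      have a2 := hym _ ⟨hby, rfl⟩
      simp only at a1 a2
      constructor <;> (ext <;> simp <;> omega)) (by simp; omega)
    simp only at this
    constructor
    · intro i hi'
      have := hxm (i, 0) ⟨hi', rfl⟩
      simp only at this
      omega
    · intro i hi'
      have := hym (i, 1) ⟨hi', rfl⟩
      simp only at this
      omega
  obtain ⟨hc0, hb1⟩ := h1
  -- step 2
  have h2 : ∀ y, b y ≠ 0 → y.1 = 0 := by
    by_contra! hcon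
    obtain ⟨⟨k1, l1⟩, hby1, hk1⟩ := hcon
    simp only at hk1
    have hl1 : 2 ≤ l1 := by
      obtain ⟨m, hm⟩ := hbo _ hby1
      simp only at hm
      rcases Nat.eq_zero_or_pos m with h | h
      · subst h
        simp only [mul_zero, zero_add] at hm
        subst hm
        exact absurd (hb1 _ hby1) hk1
      · omega
    let f1 : ℕ × ℕ → ℚ := fun x => ((x.1 : ℚ) - 1) / x.2
    let f2 : ℕ × ℕ → ℚ := fun y => (y.1 : ℚ) / ((y.2 : ℚ) - 1)
    let Q : Finset ℚ := ((Sc.filter fun x => 1 ≤ x.2).image f1) ∪ ((Sb.filter fun x => 2 ≤ x.2).image f2)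
    obtain ⟨s, hsQ, hsm⟩ := Finset.exists_max_image Q id
      ⟨f2 (k1, l1), Finset.mem_union_right _ (Finset.mem_image_of_mem _ (by simp [mSb, hby1, hl1]))⟩
    have hspos : 0 < s := by
      have := hsm (f2 (k1, l1)) (Finset.mem_union_right _ (Finset.mem_image_of_mem _ (by simp [mSb, hby1, hl1])))
      refine lt_of_lt_of_le ?_ this
      simp only [f2, id]
      have a1 : (0 : ℚ) < k1 := by exact_mod_cast Nat.pos_of_ne_zero hk1
      have a2 : (2 : ℚ) ≤ l1 := by exact_mod_cast hl1
      exact div_pos a1 (by linarith)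
    have w1 : ∀ i j, c (i, j) ≠ 0 → (i : ℚ) ≤ 1 + s * j := by
      intro i j hij
      rcases Nat.eq_zero_or_pos j with rfl | hj
      · have := hc0 i hij
        simp; exact_mod_cast this
      · have := hsm (f1 (i, j)) (Finset.mem_union_left _ (Finset.mem_image_of_mem _ (by
          simp [mSc, hij]; omega)))
        simp only [f1, id] at this
        have hj' : (0 : ℚ) < j := by exact_mod_cast hj
        rw [div_le_iff₀ hj'] at this
        linarith
    have w2 : ∀ i j, b (i, j) ≠ 0 → (i : ℚ) ≤ s * (j - 1) := by
      intro i j hij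
      obtain ⟨m, hm⟩ := hbo _ hij
      simp only at hm
      by_cases hj : j = 1
      · subst hj
        rw [hb1 i hij]; simp
      · have h2j : 2 ≤ j := by omega
        have := hsm (f2 (i, j)) (Finset.mem_union_right _ (Finset.mem_image_of_mem _ (by
          simp [mSb, hij, h2j])))
        simp only [f2, id] at this
        have hj' : (2 : ℚ) ≤ j := by exact_mod_cast h2j
        rw [div_le_iff₀ (by linarith)] at this
        linarith
    obtain ⟨⟨i0, j0⟩, hx0, hxm⟩ := Finset.exists_max_image
      (Sc.filter fun x => (x.1 : ℚ) = 1 + s * x.2) (fun x => x.2) ⟨(1, 0), by simp [mSc, hc10]⟩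
    obtain ⟨⟨k0, l0⟩, hy0, hym⟩ := Finset.exists_max_image
      (Sb.filter fun x => (x.1 : ℚ) = s * (x.2 - 1)) (fun x => x.2) ⟨(0, 1), by simp [mSb, hb01]⟩
    simp only [Finset.mem_filter, mSc, mSb] at hx0 hxm hy0 hym
    obtain ⟨hx0, hxe⟩ := hx0
    obtain ⟨hy0, hye⟩ := hy0
    have hl0 : 1 ≤ l0 := by
      obtain ⟨m, hm⟩ := hbo _ hy0
      simp only at hm
      omega
    have := EP (i0, j0) (k0, l0) hx0 hy0 (by
      rintro ⟨i, j⟩ ⟨k', l⟩ hcx hby e1 e2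
      simp only at e1 e2
      have a1 := w1 _ _ hcx
      have a2 := w2 _ _ hby
      have e1' : (i : ℚ) + k' = i0 + k0 := by exact_mod_cast e1
      have e2' : (j : ℚ) + l = j0 + l0 := by exact_mod_cast e2
      have e3 : s * j + s * l = s * j0 + s * l0 := by rw [← mul_add, e2', mul_add]
      have q1 : (i : ℚ) = 1 + s * j := by linarith
      have q2 : (k' : ℚ) = s * (l - 1) := by linarith
      have m1 := hxm (i, j) ⟨hcx, q1⟩
      have m2 := hym (k', l) ⟨hby, q2⟩
      simp only at m1 m2
      have hj : j = j0 := by omega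
      have hl : l = l0 := by omega
      subst hj; subst hl
      have hi : i = i0 := by
        have : (i : ℚ) = i0 := by rw [q1, hxe]
        exact_mod_cast this
      subst hi
      constructor <;> (ext <;> simp <;> omega)) (by
      simp only
      intro he
      have he' : (l0 : ℚ) * i0 = k0 * j0 := by exact_mod_cast he
      rw [hxe, hye] at he'
      have b1 : (1 : ℚ) ≤ l0 := by exact_mod_cast hl0
      have b2 : 0 ≤ s * j0 := mul_nonneg hspos.le (Nat.cast_nonneg _)
      nlinarith)
    simp only at this
    have hj0 : j0 = 0 := by omega
    have hl0' : l0 = 1 := by omega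
    rcases Finset.mem_union.mp hsQ with hh | hh
    · obtain ⟨⟨i, j⟩, hm, he⟩ := Finset.mem_image.mp hh
      simp only [Finset.mem_filter, mSc, f1] at hm he
      have hjp : (0 : ℚ) < j := by exact_mod_cast hm.2
      rw [div_eq_iff hjp.ne'] at he
      have := hxm (i, j) ⟨hm.1, by simp only; linarith⟩
      simp only at this
      omega
    · obtain ⟨⟨i, j⟩, hm, he⟩ := Finset.mem_image.mp hh
      simp only [Finset.mem_filter, mSb, f2] at hm he
      have hjp : (2 : ℚ) ≤ j := by exact_mod_cast hm.2
      have hne : (j : ℚ) - 1 ≠ 0 := by linarith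
      rw [div_eq_iff hne] at he
      have := hym (i, j) ⟨hm.1, by simp only; linarith⟩
      simp only at this
      omega
  -- step 3
  obtain ⟨⟨im, jm⟩, hxi, hximax⟩ := Finset.exists_max_image Sc (fun x => x.1) ⟨(1, 0), by simp [mSc, hc10]⟩
  simp only [mSc] at hxi hximax
  obtain ⟨⟨i0, j0⟩, hx0, hxm⟩ := Finset.exists_max_image (Sc.filter fun x => x.1 = im) (fun x => x.2)
    ⟨(im, jm), by simp [mSc, hxi]⟩
  obtain ⟨⟨k0, l0⟩, hy0, hym⟩ := Finset.exists_max_image Sb (fun x => x.2) ⟨(0, 1), by simp [mSb, hb01]⟩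
  simp only [Finset.mem_filter, mSc, mSb] at hx0 hxm hy0 hym
  obtain ⟨hx0, rfl⟩ := hx0
  have hk0 := h2 _ hy0
  simp only at hk0
  subst hk0
  have hi0 := hximax (1, 0) hc10
  have hl0 := hym (0, 1) hb01
  simp only at hi0 hl0
  have hfin := EP (i0, j0) (0, l0) hx0 hy0 (by
    rintro ⟨i, j⟩ ⟨k', l⟩ hcx hby e1 e2
    have a1 := h2 _ hby
    simp only at a1 e1 e2
    subst a1
    have hi : i = i0 := by omega
    subst hi
    have m1 := hxm (i, j) ⟨hcx, rfl⟩
    have m2 := hym (0, l) hby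
    simp only at m1 m2
    constructor <;> (ext <;> simp <;> omega)) (by
    simp only [zero_mul]
    exact Nat.mul_ne_zero (by omega) (by omega))
  simp only at hfin
  rintro ⟨k', l⟩ hby
  have a1 := h2 _ hby
  have a2 := hym _ hby
  obtain ⟨m, hm⟩ := hbo _ hby
  simp only at a1 a2 hm
  ext <;> simp <;> omega

end comb

end Part6

section Part7

section modp
variable {A k : Type} [CommRing A] [Field k] (p : ℕ) [Fact p.Prime] [CharP k p] (π : A →+* k)

theorem tr_mono (hodd : Odd p) (i j : ℕ) :
    tr ((Wx k ^ p) ^ i * (Wy k ^ p) ^ j) = ((-1 : k) ^ j) • ((Wx k ^ p) ^ i * (Wy k ^ p) ^ j) := by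
  have hy : tr (Wy k) = (-1 : k) • Wy k := by
    rw [tr_y]; exact (neg_one_smul k (Wy k)).symm
  rw [tr_mul, tr_pow, tr_pow, tr_pow, tr_pow, tr_x, hy, _root_.smul_pow, hodd.neg_one_pow, _root_.smul_pow,
    smul_mul_assoc]
  congr 1
  have h2 : Commute (Wy k ^ p) ((Wx k ^ p) ^ i) := V_central p _
  exact (h2.pow_left j).eq

theorem parity (hodd : Odd p) {z : Weyl k} (hz : ∀ w, z * w = w * z) {n : ℕ}
    (hn : tdeg (p * n) (sym z)) {ε : k} (ht : tr z = ε • z) (a : ℕ × ℕ)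
    (ha : pc p z a ≠ 0) : ε = (-1) ^ a.2 := by
  have hp : 0 < p := (Fact.out : p.Prime).pos
  have hmem : a ∈ bx n := by
    have hle : ¬ (p * n < p * a.1 + p * a.2) := fun h' => ha (hn _ _ h')
    have hle2 : a.1 + a.2 ≤ n := by
      rw [← mul_add] at hle
      exact le_of_mul_le_mul_left (not_lt.mp hle) hp
    simp [bx]; omega
  have h1 := central_eq p hz hn
  have h2 : tr z = ∑ a ∈ bx n, pc p z a • (((-1 : k) ^ a.2) • ((Wx k ^ p) ^ a.1 * (Wy k ^ p) ^ a.2)) := by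
    conv_lhs => rw [h1]
    rw [tr_sum]
    refine Finset.sum_congr rfl fun a _ => ?_
    rw [tr_smul, tr_mono p hodd]
  have h3 : pc p (tr z) a = pc p z a * (-1) ^ a.2 := by
    rw [h2]
    conv_lhs => rw [pc]
    simp only [sym_sum, sym_smul, finsetSum_coeff, coeff_smul, ← pow_mul, coeff_sym_xy]
    rw [Finset.sum_eq_single_of_mem a hmem]
    · simp
    · rintro x _ hne
      have : ¬ (p * x.1 = p * a.1 ∧ p * x.2 = p * a.2) := by
        rintro ⟨h1, h2⟩
        exact hne (Prod.ext (Nat.eq_of_mul_eq_mul_left hp h1) (Nat.eq_of_mul_eq_mul_left hp h2))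
      simp only [this, if_false, smul_zero]
  rw [ht] at h3
  have h4 : pc p (ε • z) a = ε * pc p z a := by simp [pc]
  rw [h4, mul_comm] at h3
  exact mul_left_cancel₀ ha h3

theorem modp_main (hp2 : (p : A) * p = 0) (hk1 : ∀ a, π a = 0 → ∃ b, a = p * b)
    (hk2 : ∀ a, (p : A) * a = 0 → π a = 0) {S D : Weyl A} (h : D * S = S * D + 1) {n : ℕ}
    (hS : tdeg n (sym (wmap π S))) (hD : tdeg n (sym (wmap π D))) (hodd : Odd p)
    (hn : n * n < p) (hSt : tr (wmap π S) = wmap π S) (hDt : tr (wmap π D) = (-1 : k) • wmap π D)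
    (i j : ℕ) (hij : ¬ (i = 0 ∧ j = 1)) : ((sym (wmap π D)).coeff i).coeff j = 0 := by
  have hp : 0 < p := (Fact.out : p.Prime).pos
  have hB := bracket_coeff p π hp2 hk1 hk2 h hS hD
  have hk : wmap π D * wmap π S = wmap π S * wmap π D + 1 := by
    rw [← map_mul, h, map_add, map_mul, map_one]
  generalize wmap π S = S' at *
  generalize wmap π D = D' at *
  have hSc := S_pow_central p hk
  have hDc := D_pow_central p hk
  have hne : (-1 : k) ≠ 1 := by
    intro he
    have h2 : ((2 : ℕ) : k) = 0 := by
      push_cast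
      linear_combination (-1 : k) * he
    rw [CharP.cast_eq_zero_iff k p] at h2
    obtain ⟨m, hm⟩ := hodd
    have := Nat.le_of_dvd (by omega) h2
    have := (Fact.out : p.Prime).two_le
    omega
  have hbd : ∀ z : Weyl k, tdeg (p * n) (sym z) → ∀ a, pc p z a ≠ 0 → a.1 ≤ n ∧ a.2 ≤ n := by
    intro z hz a ha
    have hle : ¬ (p * n < p * a.1 + p * a.2) := fun h' => ha (hz _ _ h')
    have hle2 : a.1 + a.2 ≤ n := by
      rw [← mul_add] at hle
      exact le_of_mul_le_mul_left (not_lt.mp hle) hp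
    omega
  have hmain := comb_main (k := k) p hn (c := pc p (S' ^ p)) (b := pc p (D' ^ p))
    (hbd _ (tdeg_pow hS p)) (hbd _ (tdeg_pow hD p)) hB (by
      intro x hx
      have := parity p hodd hSc (tdeg_pow hS p) (ε := 1) (by rw [tr_pow, hSt, one_smul]) x hx
      by_contra hc
      rw [Nat.not_even_iff_odd] at hc
      rw [hc.neg_one_pow] at this
      exact hne this.symm) (by
      intro x hx
      have := parity p hodd hDc (tdeg_pow hD p) (ε := -1) (by
        rw [tr_pow, hDt, _root_.smul_pow, hodd.neg_one_pow]) x hx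
      by_contra hc
      rw [Nat.not_odd_iff_even] at hc
      rw [hc.neg_one_pow] at this
      exact hne this)
  obtain ⟨β, hβ⟩ : ∃ β : k, D' ^ p = β • Wy k ^ p := by
    rw [central_eq p hDc (tdeg_pow hD p)]
    by_cases h1 : (0, 1) ∈ bx n
    · refine ⟨_, (Finset.sum_eq_single_of_mem (0, 1) h1 ?_).trans (by rw [pow_zero, one_mul, pow_one])⟩
      intro a _ hne'
      by_cases h0 : pc p (D' ^ p) a = 0
      · rw [h0, zero_smul]
      · exact absurd (hmain a h0) hne'
    · refine ⟨0, ?_⟩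
      rw [zero_smul]
      refine Finset.sum_eq_zero fun a ha => ?_
      by_cases h0 : pc p (D' ^ p) a = 0
      · rw [h0, zero_smul]
      · rw [hmain a h0] at ha; exact absurd ha h1
  have hD0 : D' ≠ 0 := by
    rintro rfl
    simp at hk
  have hsym : sym (D' ^ p) = C (C β * X ^ p) := by
    rw [hβ, sym_smul, sym_ypow, smul_C, smul_eq_C_mul]
  have hnd := sym_natDegree_pow hD0 p
  rw [hsym, natDegree_C] at hnd
  have hnd0 : (sym D').natDegree = 0 := by
    rcases Nat.mul_eq_zero.mp hnd.symm with h | h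
    · omega
    · exact h
  obtain ⟨d, hd⟩ := natDegree_eq_zero.mp hnd0
  have hDd : D' = aeval (Wy k) d := by
    apply sym_inj; rw [sym_aeval_y, hd]
  have hdp : d ^ p = C β * X ^ p := by
    rw [hDd, ← map_pow, sym_aeval_y] at hsym
    exact C_injective hsym
  have hdeg : d.natDegree ≤ 1 := by
    have h1 : (d ^ p).natDegree ≤ p := by rw [hdp]; exact natDegree_C_mul_X_pow_le _ _
    rw [natDegree_pow] at h1
    by_contra hc
    have : p * 2 ≤ p * d.natDegree := Nat.mul_le_mul_left p (by omega)
    omega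
  have hd0 : d.coeff 0 = 0 := by
    have := congrArg (eval 0) hdp
    simp [hp.ne'] at this
    rw [coeff_zero_eq_eval_zero, this]
  rw [← hd, coeff_C]
  split_ifs with hi
  · rcases j with _ | _ | j
    · exact hd0
    · exact absurd ⟨hi, rfl⟩ hij
    · exact coeff_eq_zero_of_natDegree_lt (by omega)
  · simp

end modp

end Part7

section Part8

theorem exists_numberField_aux (R : Type) [CommRing R] [Nontrivial R] [Algebra ℚ R]
    (ft : Algebra.FiniteType ℚ R) :
    ∃ (E : Type) (_ : Field E) (_ : NumberField E), Nonempty (R →+* E) := by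
  obtain ⟨m, hm⟩ := Ideal.exists_maximal R
  have ft2 : Algebra.FiniteType ℚ (R ⧸ m) :=
    ft.of_surjective (Ideal.Quotient.mkₐ ℚ m) (Ideal.Quotient.mkₐ_surjective ℚ m)
  let al : Algebra ℚ (R ⧸ m) := inferInstance
  let F : Field (R ⧸ m) := Ideal.Quotient.field m
  have fin : @Module.Finite ℚ (R ⧸ m) _ _ al.toModule :=
    @finite_of_finite_type_of_isJacobsonRing ℚ (R ⧸ m) _ F al _ ft2
  have cz : CharZero (R ⧸ m) := @algebraRat.charZero (R ⧸ m) _ _ al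
  refine ⟨R ⧸ m, F, ?_, ⟨Ideal.Quotient.mk m⟩⟩
  refine @NumberField.mk _ F cz ?_
  have e : al = @DivisionRing.toRatAlgebra (R ⧸ m) _ cz := Subsingleton.elim _ _
  rw [e] at fin
  exact fin

theorem exists_numberField {K : Type} [Field K] [CharZero K] (s : Finset K) :
    ∃ (R₀ E : Type) (_ : CommRing R₀) (_ : Field E) (_ : NumberField E) (ι : R₀ →+* K)
      (_ : R₀ →+* E), Function.Injective ι ∧ ∀ x ∈ s, x ∈ Set.range ι := by
  have ft : Algebra.FiniteType ℚ (Algebra.adjoin ℚ (s : Set K)) :=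
    (Subalgebra.fg_iff_finiteType _).1 ⟨s, rfl⟩
  obtain ⟨E, hE, hN, ⟨φ⟩⟩ := exists_numberField_aux _ ft
  refine ⟨_, E, inferInstance, hE, hN,
    (Algebra.adjoin ℚ (s : Set K)).val.toRingHom, φ, Subtype.val_injective, ?_⟩
  intro x hx
  exact ⟨⟨x, Algebra.subset_adjoin hx⟩, rfl⟩

open NumberField in
theorem exists_prime_ideal (E : Type) [Field E] [NumberField E] (b : 𝓞 E) (hb : b ≠ 0) (N : ℕ) :
    ∃ (p : ℕ) (_ : Fact p.Prime) (P : Ideal (𝓞 E)), N < p ∧ P.IsMaximal ∧ (p : 𝓞 E) ∈ P ∧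
      (p : 𝓞 E) ∉ P ^ 2 ∧ b ∉ P := by
  obtain ⟨p, hp, hpp⟩ := Nat.exists_infinite_primes
    (N + (discr E).natAbs + Ideal.absNorm (Ideal.span {b}) + 1)
  have : Fact p.Prime := ⟨hpp⟩
  have hpZ : Prime (p : ℤ) := Nat.prime_iff_prime_int.1 hpp
  have hp0 : (Ideal.span {(p : ℤ)}) ≠ ⊥ := by
    simpa using hpp.ne_zero
  have : (Ideal.span {(p : ℤ)}).IsMaximal :=
    ((Ideal.span_singleton_prime hpZ.ne_zero).2 hpZ).isMaximal hp0
  obtain ⟨P, hP, hPo⟩ := Ideal.exists_maximal_ideal_liesOver_of_isIntegral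
    (S := 𝓞 E) (Ideal.span {(p : ℤ)})
  have key : ∀ z : ℤ, (z : 𝓞 E) ∈ P → z.natAbs < p → z = 0 := by
    intro z hz hzp
    have h1 : z ∈ Ideal.span {(p : ℤ)} := by
      rw [hPo.over, Ideal.mem_comap]; simpa using hz
    rw [Ideal.mem_span_singleton] at h1
    exact Int.eq_zero_of_dvd_of_natAbs_lt_natAbs h1 (by simpa using hzp)
  have hpP : (p : 𝓞 E) ∈ P := by
    have h1 : (p : ℤ) ∈ Ideal.comap (algebraMap ℤ (𝓞 E)) P := by
      have := hPo.over
      rw [Ideal.under_def] at this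
      rw [← this]
      exact Ideal.mem_span_singleton_self _
    simpa using h1
  refine ⟨p, ⟨hpp⟩, P, by omega, hP, hpP, ?_, ?_⟩
  · intro h2
    have h3 : P ^ 2 ∣ (Ideal.span {(p : ℤ)}).map (algebraMap ℤ (𝓞 E)) := by
      rw [Ideal.dvd_iff_le, Ideal.map_span, Ideal.span_le]
      simpa using h2
    have h4 := pow_sub_one_dvd_differentIdeal (A := ℤ) P 2 hp0 h3
    rw [show 2 - 1 = 1 from rfl, pow_one, Ideal.dvd_iff_le] at h4
    have h5 := h4 (discr_mem_differentIdeal E (𝓞 E))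
    exact discr_ne_zero E (key _ h5 (by omega))
  · intro h2
    have h3 : Ideal.span {b} ≤ P := by
      rw [Ideal.span_le]; simpa using h2
    have h4 := h3 (Ideal.absNorm_mem (Ideal.span {b}))
    have h5 := key (Ideal.absNorm (Ideal.span {b}) : ℤ) (by simpa using h4) (by rw [Int.natAbs_natCast]; omega)
    have h6 : Ideal.absNorm (Ideal.span {b}) = 0 := by exact_mod_cast h5
    rw [Ideal.absNorm_eq_zero_iff] at h6
    exact hb (by simpa using h6)

end Part8

section Part9

theorem sup_sq_of_not_mem {O : Type} [CommRing O] [IsDedekindDomain O] (P : Ideal O)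
    [hP : P.IsMaximal] (q : O) (hq : q ∈ P) (hq2 : q ∉ P ^ 2) (x : O) (hx : x ∈ P) :
    ∃ c, x - q * c ∈ P ^ 2 := by
  have hP0 : P ≠ ⊥ := by
    rintro rfl
    rw [Ideal.mem_bot] at hq
    exact hq2 (hq ▸ Ideal.zero_mem _)
  have hPp : Prime P := Ideal.prime_of_isPrime hP0 hP.isPrime
  have h1 : Ideal.span {q} ⊔ P ^ 2 ∣ P ^ 2 := Ideal.dvd_iff_le.2 le_sup_right
  obtain ⟨i, hi, h2⟩ := (dvd_prime_pow hPp 2).1 h1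
  rw [associated_iff_eq] at h2
  have hmem : q ∈ Ideal.span {q} ⊔ P ^ 2 :=
    (le_sup_left : _ ≤ Ideal.span {q} ⊔ P ^ 2) (Ideal.mem_span_singleton_self q)
  have h3 : Ideal.span {q} ⊔ P ^ 2 = P := by
    interval_cases i
    · exfalso
      apply hP.ne_top
      rw [pow_zero, Ideal.one_eq_top] at h2
      rw [eq_top_iff, ← h2]
      refine sup_le ?_ (Ideal.pow_le_self two_ne_zero)
      rw [Ideal.span_le]; simpa using hq
    · simpa using h2
    · exact absurd (h2 ▸ hmem) hq2
  rw [← h3] at hx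
  obtain ⟨y, hy, z, hz, e⟩ := Submodule.mem_sup.1 hx
  obtain ⟨c, rfl⟩ := Ideal.mem_span_singleton'.1 hy
  refine ⟨c, ?_⟩
  rw [← e]
  convert hz using 1
  ring

theorem mem_of_mul_mem_sq {O : Type} [CommRing O] (P : Ideal O)
    [hP : P.IsMaximal] (q : O) (hq : q ∈ P) (hq2 : q ∉ P ^ 2) (x : O) (hx : q * x ∈ P ^ 2) :
    x ∈ P := by
  by_contra h
  obtain ⟨c, e, he, hc⟩ := hP.exists_inv h
  apply hq2
  have : q = (q * x) * c + q * e := by linear_combination (-q) * hc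
  rw [this]
  refine Ideal.add_mem _ (Ideal.mul_mem_right _ _ hx) ?_
  rw [pow_two]
  exact Ideal.mul_mem_mul hq he

theorem isUnit_mk_sq {O : Type} [CommRing O] (P : Ideal O)
    [hP : P.IsMaximal] (x : O) (hx : x ∉ P) : IsUnit (Ideal.Quotient.mk (P ^ 2) x) := by
  obtain ⟨c, e, he, hc⟩ := hP.exists_inv hx
  have h : (Ideal.Quotient.mk (P ^ 2)) (e ^ 2) = 0 :=
    Ideal.Quotient.eq_zero_iff_mem.2 (Ideal.pow_mem_pow he 2)
  refine IsUnit.of_mul_eq_one (Ideal.Quotient.mk (P ^ 2) (c * (1 + e))) ?_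
  rw [← map_mul, ← map_one (Ideal.Quotient.mk (P ^ 2)), ← sub_eq_zero, ← map_sub,
    show x * (c * (1 + e)) - 1 = - e ^ 2 by linear_combination (1 + e) * hc, map_neg, h, neg_zero]

open NumberField in
theorem exists_reduction {K : Type} [Field K] [CharZero K] (s : Finset K) (N : ℕ) :
    ∃ (p : ℕ) (_ : Fact p.Prime) (R A k : Type) (_ : CommRing R) (_ : CommRing A) (_ : Field k)
      (_ : CharP k p) (ι : R →+* K) (_ : R →+* A) (π : A →+* k), N < p ∧
      Function.Injective ι ∧ (∀ x ∈ s, x ∈ Set.range ι) ∧ (p : A) * p = 0 ∧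
      (∀ a, π a = 0 → ∃ b, a = p * b) ∧ (∀ a, (p : A) * a = 0 → π a = 0) := by
  classical
  obtain ⟨R₀, E, _, _, _, ι₀, φ, hι, hs⟩ := exists_numberField s
  choose! r hr using hs
  obtain ⟨b, hb⟩ := IsLocalization.exist_integer_multiples_of_finset (nonZeroDivisors (𝓞 E))
    (s.image fun x => φ (r x))
  obtain ⟨p, hp, P, hN, hP, hpP, hpP2, hbP⟩ := exists_prime_ideal E b
    (nonZeroDivisors.coe_ne_zero b) N
  have hS : P.primeCompl ≤ nonZeroDivisors (𝓞 E) := P.primeCompl_le_nonZeroDivisors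
  let T := Localization.subalgebra.ofField E P.primeCompl hS
  have hu : ∀ y : P.primeCompl, IsUnit (Ideal.Quotient.mk (P ^ 2) (y : 𝓞 E)) :=
    fun y => isUnit_mk_sq P y y.2
  let lf : T →+* 𝓞 E ⧸ P ^ 2 := IsLocalization.lift (M := P.primeCompl) (S := T) hu
  let R : Subring R₀ := T.toSubring.comap φ
  let φ' : R →+* T := φ.restrict R T.toSubring (fun x hx => hx)
  let F : Field (𝓞 E ⧸ P) := Ideal.Quotient.field P
  have hle : P ^ 2 ≤ P := Ideal.pow_le_self two_ne_zero
  have hch : CharP (𝓞 E ⧸ P) p := by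
    refine ringChar.of_eq (CharP.ringChar_of_prime_eq_zero hp.out ?_)
    rw [← map_natCast (Ideal.Quotient.mk P)]
    exact Ideal.Quotient.eq_zero_iff_mem.2 hpP
  refine ⟨p, hp, R, 𝓞 E ⧸ P ^ 2, 𝓞 E ⧸ P, inferInstance, inferInstance, F, hch,
    ι₀.comp R.subtype, lf.comp φ', Ideal.Quotient.factor hle, hN,
    hι.comp Subtype.val_injective, ?_, ?_, ?_, ?_⟩
  · intro x hx
    refine ⟨⟨r x, ?_⟩, hr x hx⟩
    change φ (r x) ∈ T
    obtain ⟨a, ha⟩ := hb (φ (r x)) (Finset.mem_image_of_mem _ hx)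
    refine ⟨a, b, hbP, ?_⟩
    have hb0 : algebraMap (𝓞 E) E b ≠ 0 := by
      simpa using nonZeroDivisors.coe_ne_zero b
    rw [ha, Algebra.smul_def]
    field_simp
  · rw [← map_natCast (Ideal.Quotient.mk (P ^ 2)), ← map_mul]
    refine Ideal.Quotient.eq_zero_iff_mem.2 ?_
    rw [pow_two]
    exact Ideal.mul_mem_mul hpP hpP
  · intro a ha
    obtain ⟨a, rfl⟩ := Ideal.Quotient.mk_surjective a
    rw [Ideal.Quotient.factor_mk] at ha
    obtain ⟨c, hc⟩ := sup_sq_of_not_mem P p hpP hpP2 a (Ideal.Quotient.eq_zero_iff_mem.1 ha)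
    refine ⟨Ideal.Quotient.mk _ c, ?_⟩
    rw [← map_natCast (Ideal.Quotient.mk (P ^ 2)), ← map_mul]
    exact Ideal.Quotient.eq.2 hc
  · intro a ha
    obtain ⟨a, rfl⟩ := Ideal.Quotient.mk_surjective a
    rw [Ideal.Quotient.factor_mk]
    rw [← map_natCast (Ideal.Quotient.mk (P ^ 2)), ← map_mul] at ha
    exact Ideal.Quotient.eq_zero_iff_mem.2
      (mem_of_mul_mem_sq P p hpP hpP2 a (Ideal.Quotient.eq_zero_iff_mem.1 ha))

end Part9

section Part10

theorem exists_wlift_coeff {R K : Type} [CommRing R] [CommRing K] (ι : R →+* K) {w : Weyl K} {n : ℕ}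
    (h : tdeg n (sym w))
    (hr : ∀ i < n + 1, ∀ j < n + 1, ((sym w).coeff i).coeff j ∈ Set.range ι) :
    ∃ w' : Weyl R, wmap ι w' = w := by
  choose! r hr using hr
  refine ⟨∑ i ∈ Finset.range (n+1), ∑ j ∈ Finset.range (n+1), r i j • (Wx R ^ i * Wy R ^ j), ?_⟩
  conv_rhs => rw [eq_sum_of_tdeg h]
  rw [map_sum]
  refine Finset.sum_congr rfl fun i hi => ?_
  rw [map_sum]
  refine Finset.sum_congr rfl fun j hj => ?_
  rw [wmap_smul, map_mul, map_pow, map_pow, wmap_x, wmap_y,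
    hr i (Finset.mem_range.1 hi) j (Finset.mem_range.1 hj)]

theorem tdeg_wmap {R K : Type} [CommRing R] [CommRing K] (φ : R →+* K) {w : Weyl R} {n : ℕ}
    (h : tdeg n (sym w)) : tdeg n (sym (wmap φ w)) := by
  intro i j hij
  rw [coeff_wmap, h i j hij, map_zero]

theorem tdeg_of_wmap {R K : Type} [CommRing R] [CommRing K] (φ : R →+* K)
    (hφ : Function.Injective φ) {w : Weyl R} {n : ℕ}
    (h : tdeg n (sym (wmap φ w))) : tdeg n (sym w) := by
  intro i j hij
  apply hφ
  rw [← coeff_wmap, h i j hij, map_zero]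

theorem D_linear {K : Type} [Field K] [CharZero K] {S D : Weyl K} (h : D * S = S * D + 1)
    (hS : tr S = S) (hD : tr D = (-1 : K) • D) (i j : ℕ) (hij : ¬ (i = 0 ∧ j = 1)) :
    ((sym D).coeff i).coeff j = 0 := by
  classical
  by_contra hc
  obtain ⟨n₁, hn₁⟩ := exists_tdeg (sym S)
  obtain ⟨n₂, hn₂⟩ := exists_tdeg (sym D)
  obtain ⟨n, hn1, hn2⟩ : ∃ n, n₁ ≤ n ∧ n₂ ≤ n := ⟨max n₁ n₂, le_max_left _ _, le_max_right _ _⟩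
  replace hn₁ := hn₁.mono hn1
  replace hn₂ := hn₂.mono hn2
  let q := Finset.range (n+1) ×ˢ Finset.range (n+1)
  let s : Finset K := insert (((sym D).coeff i).coeff j)⁻¹
    ((q.image fun x => ((sym S).coeff x.1).coeff x.2) ∪
      (q.image fun x => ((sym D).coeff x.1).coeff x.2))
  obtain ⟨p, hp, R, A, k, _, _, _, _, ι, ψ, π, hN, hι, hs, hp2, hk1, hk2⟩ :=
    exists_reduction s (n * n + 2)
  obtain ⟨S', rfl⟩ : ∃ S', wmap ι S' = S := by
    refine exists_wlift_coeff ι hn₁ fun i hi j hj => hs _ ?_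
    refine Finset.mem_insert_of_mem (Finset.mem_union_left _ ?_)
    exact Finset.mem_image.2 ⟨(i, j), by simp [q]; omega, rfl⟩
  obtain ⟨D', rfl⟩ : ∃ D', wmap ι D' = D := by
    refine exists_wlift_coeff ι hn₂ fun i hi j hj => hs _ ?_
    refine Finset.mem_insert_of_mem (Finset.mem_union_right _ ?_)
    exact Finset.mem_image.2 ⟨(i, j), by simp [q]; omega, rfl⟩
  obtain ⟨c', hc'⟩ := hs _ (Finset.mem_insert_self _ _)
  rw [coeff_wmap] at hc hc'
  have hinj := wmap_injective ι hι
  have h' : D' * S' = S' * D' + 1 := by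
    apply hinj
    rw [map_mul, map_add, map_mul, map_one, h]
  have hS' : tr S' = S' := by
    apply hinj
    rw [← tr_wmap, hS]
  have hD' : tr D' = (-1 : R) • D' := by
    apply hinj
    rw [← tr_wmap, hD, wmap_smul, map_neg, map_one]
  have h'' : wmap ψ D' * wmap ψ S' = wmap ψ S' * wmap ψ D' + 1 := by
    rw [← map_mul, h', map_add, map_mul, map_one]
  have := modp_main p π hp2 hk1 hk2 h'' (n := n)
    (tdeg_wmap π (tdeg_wmap ψ (tdeg_of_wmap ι hι hn₁)))
    (tdeg_wmap π (tdeg_wmap ψ (tdeg_of_wmap ι hι hn₂)))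
    (hp.out.odd_of_ne_two (by omega)) (by omega)
    (by rw [tr_wmap, tr_wmap, hS'])
    (by rw [tr_wmap, tr_wmap, hD', wmap_smul, wmap_smul, map_neg, map_neg, map_one, map_one])
    i j hij
  rw [coeff_wmap, coeff_wmap] at this
  have h1 : c' * ((sym D').coeff i).coeff j = 1 := by
    apply hι
    rw [map_mul, hc', map_one, inv_mul_cancel₀ hc]
  have h2 := congrArg (fun x => π (ψ x)) h1
  simp only [map_mul, map_one, this, mul_zero] at h2
  exact zero_ne_one h2

theorem SD_form {K : Type} [Field K] [CharZero K] {S D : Weyl K} (h : D * S = S * D + 1)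
    (hS : tr S = S) (hD : tr D = (-1 : K) • D) :
    ∃ (c : K) (t : Polynomial K), c ≠ 0 ∧ D = c • Wy K ∧ S = c⁻¹ • Wx K + aeval (Wy K) t := by
  have hl := D_linear h hS hD
  obtain ⟨c, hcd⟩ : ∃ c, c = ((sym D).coeff 0).coeff 1 := ⟨_, rfl⟩
  have hDc : D = c • Wy K := by
    apply sym_inj
    ext i j
    have e := coeff_sym_xy (R := K) 0 1 i j
    rw [pow_zero, one_mul, pow_one] at e
    rw [sym_smul, coeff_smul, coeff_smul, e]
    by_cases hij : i = 0 ∧ j = 1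
    · obtain ⟨rfl, rfl⟩ := hij
      simp [hcd]
    · rw [hl i j hij, if_neg (by omega), smul_zero]
  have hc : c ≠ 0 := by
    intro h0
    rw [hDc, h0, zero_smul, zero_mul, mul_zero, zero_add] at h
    exact zero_ne_one h
  have had : Wy K * S - S * Wy K = c⁻¹ • (1 : Weyl K) := by
    rw [hDc, smul_mul_assoc, mul_smul_comm] at h
    have h1 : Wy K * S = S * Wy K + c⁻¹ • (1 : Weyl K) := by
      have := congrArg (fun x => c⁻¹ • x) h
      simpa [smul_smul, inv_mul_cancel₀ hc, smul_add] using this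
    rw [h1]
    exact add_sub_cancel_left (S * Wy K) _
  have hder : derivative (sym S) = C (C c⁻¹) := by
    rw [← sym_ady, had, sym_smul, sym_one]
    rw [← C_1, smul_C, ← C_1, smul_C, smul_eq_mul, mul_one]
  refine ⟨c, (sym S).coeff 0, hc, hDc, ?_⟩
  apply sym_inj
  rw [sym_add, sym_smul, sym_aeval_y]
  have ex : sym (Wx K) = X := by
    have := sym_xmul (1 : Weyl K)
    simpa using this
  rw [ex]
  ext1 i
  rcases i with _ | i
  · simp
  · have h1 := congrArg (fun m => m.coeff i) hder
    simp only [coeff_derivative] at h1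
    have h2 : ((i : Polynomial K) + 1) ≠ 0 := by exact_mod_cast Nat.succ_ne_zero i
    rcases i with _ | i
    · simp at h1
      rw [zero_add, h1]
      simp [coeff_X, smul_eq_C_mul]
    · rw [coeff_C, if_neg (Nat.succ_ne_zero i)] at h1
      have h3 := (mul_eq_zero.1 h1).resolve_right (by exact_mod_cast h2)
      rw [h3]
      simp [coeff_X]

end Part10

section Part11

theorem shear_rel {K B : Type} [Field K] [Ring B] [Algebra K B] {x y : B} (h : y * x = x * y + 1)
    (c : K) (hc : c ≠ 0) (t : Polynomial K) :
    (c • y) * (c⁻¹ • x + aeval y t) = (c⁻¹ • x + aeval y t) * (c • y) + 1 := by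
  have e : y * aeval y t = aeval y t * y := by
    have h2 : aeval y (X * t) = aeval y (t * X) := by rw [mul_comm]
    simpa using h2
  rw [mul_add, add_mul, smul_mul_smul_comm, smul_mul_smul_comm, h, smul_mul_assoc, e,
    mul_smul_comm, mul_inv_cancel₀ hc, inv_mul_cancel₀ hc, one_smul, one_smul]
  abel

def shear {K : Type} [Field K] (c : K) (hc : c ≠ 0) (t : Polynomial K) : Weyl K →ₐ[K] Weyl K :=
  wlift (c⁻¹ • Wx K + aeval (Wy K) t) (c • Wy K) (shear_rel (W_rel K) c hc t)

theorem shear_comp {K : Type} [Field K] (c d : K) (hc : c ≠ 0) (hd : d ≠ 0) (hcd : c * d = 1)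
    (t u : Polynomial K) (hu : c • t + u.comp (C c * X) = 0) :
    (shear c hc t).comp (shear d hd u) = AlgHom.id K (Weyl K) := by
  have hdc : d * c = 1 := by rw [mul_comm, hcd]
  have hd1 : d⁻¹ = c := inv_eq_of_mul_eq_one_right hdc
  have hc1 : c⁻¹ = d := inv_eq_of_mul_eq_one_right hcd
  apply W_hom_ext
  · simp only [shear, AlgHom.comp_apply, wlift_x, map_add, map_smul, ← aeval_algHom_apply, wlift_y,
      smul_add, smul_smul, AlgHom.id_apply, hd1, mul_inv_cancel₀ hc, one_smul]
    have e := congrArg (aeval (Wy K)) hu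
    rw [map_add, map_smul, aeval_comp, map_zero, map_mul, aeval_C, aeval_X,
      ← Algebra.smul_def] at e
    rw [add_assoc, e, add_zero]
  · simp only [shear, AlgHom.comp_apply, wlift_y, map_smul, smul_smul, hdc, one_smul,
      AlgHom.id_apply]

theorem rot_rel {K B : Type} [Field K] [CharZero K] [Ring B] [Algebra K B] {x y : B}
    (h : y * x = x * y + 1) :
    ((1/2 : K) • y + (-1/2 : K) • x) * (x + y) = (x + y) * ((1/2 : K) • y + (-1/2 : K) • x) + 1 := by
  simp only [mul_add, add_mul, smul_mul_assoc, mul_smul_comm, h]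
  module

theorem rot_rel' {K B : Type} [Field K] [CharZero K] [Ring B] [Algebra K B] {x y : B}
    (h : y * x = x * y + 1) :
    ((1/2 : K) • x + y) * ((1/2 : K) • x + (-1 : K) • y) =
      ((1/2 : K) • x + (-1 : K) • y) * ((1/2 : K) • x + y) + 1 := by
  simp only [mul_add, add_mul, smul_mul_assoc, mul_smul_comm, h]
  module

theorem endo_algHom {K : Type} [Field K] {f : Weyl K → Weyl K} (hf : IsAlgEndo K f) :
    ∃ F : Weyl K →ₐ[K] Weyl K, ∀ w, F w = f w :=
  ⟨AlgHom.ofLinearMap ⟨⟨f, hf.1⟩, hf.2.1⟩ hf.2.2.2 hf.2.2.1, fun _ => rfl⟩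

def rot (K : Type) [Field K] [CharZero K] : Weyl K →ₐ[K] Weyl K :=
  wlift (Wx K + Wy K) ((1/2 : K) • Wy K + (-1/2 : K) • Wx K) (rot_rel (W_rel K))

def rot' (K : Type) [Field K] [CharZero K] : Weyl K →ₐ[K] Weyl K :=
  wlift ((1/2 : K) • Wx K + (-1 : K) • Wy K) ((1/2 : K) • Wx K + Wy K) (rot_rel' (W_rel K))

theorem rot_rot' (K : Type) [Field K] [CharZero K] (w : Weyl K) : rot K (rot' K w) = w := by
  have : (rot K).comp (rot' K) = AlgHom.id K (Weyl K) := by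
    apply W_hom_ext
    · simp only [rot, rot', AlgHom.comp_apply, wlift_x, wlift_y, map_add, map_smul,
        AlgHom.id_apply]
      module
    · simp only [rot, rot', AlgHom.comp_apply, wlift_x, wlift_y, map_add, map_smul,
        AlgHom.id_apply]
      module
  exact DFunLike.congr_fun this w

theorem rot'_rot (K : Type) [Field K] [CharZero K] (w : Weyl K) : rot' K (rot K w) = w := by
  have : (rot' K).comp (rot K) = AlgHom.id K (Weyl K) := by
    apply W_hom_ext
    · simp only [rot, rot', AlgHom.comp_apply, wlift_x, wlift_y, map_add, map_smul,
        AlgHom.id_apply]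
      module
    · simp only [rot, rot', AlgHom.comp_apply, wlift_x, wlift_y, map_add, map_smul,
        AlgHom.id_apply]
      module
  exact DFunLike.congr_fun this w

theorem alpha_rot {K : Type} [Field K] [CharZero K] {α : Weyl K → Weyl K} (hα : IsExchange K α)
    (w : Weyl K) : α (rot K w) = rot K (tr w) := by
  obtain ⟨⟨⟨⟨hadd, hsmul, hmul, hone⟩, _⟩, _⟩, hx, hy⟩ := hα
  have ex : α (rot K (Wx K)) = rot K (tr (Wx K)) := by
    rw [tr_x, rot, wlift_x, hadd, hx, hy, add_comm]
  have ey : α (rot K (Wy K)) = rot K (tr (Wy K)) := by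
    rw [tr_y, map_neg, rot, wlift_y, hadd, hsmul, hsmul, hx, hy]
    module
  induction w using W_induction with
  | h1 => simp [hone]
  | hadd a b ha hb => rw [map_add, hadd, ha, hb, tr_add, map_add]
  | hs c a ha => rw [map_smul, hsmul, ha, tr_smul, map_smul]
  | hx a ha => rw [map_mul, hmul, ha, ex, tr_mul, map_mul]
  | hy a ha => rw [map_mul, hmul, ha, ey, tr_mul, map_mul]

theorem shear_bijective {K : Type} [Field K] (c : K) (hc : c ≠ 0) (t : Polynomial K) :
    Function.Bijective (shear c hc t) := by
  have hcc : c * c⁻¹ = 1 := mul_inv_cancel₀ hc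
  have hcc' : c⁻¹ * c = 1 := inv_mul_cancel₀ hc
  have h1 := shear_comp c c⁻¹ hc (inv_ne_zero hc) hcc t (-(c • t.comp (C c⁻¹ * X))) (by
    rw [neg_comp, smul_comp, comp_assoc, mul_comp, C_comp, X_comp, ← mul_assoc, ← C_mul, hcc',
      C_1, one_mul, comp_X, add_neg_cancel])
  have h2 := shear_comp c⁻¹ c (inv_ne_zero hc) hc hcc' (-(c • t.comp (C c⁻¹ * X))) t (by
    rw [smul_neg, smul_smul, hcc', one_smul, neg_add_cancel])
  exact Function.bijective_iff_has_inverse.2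
    ⟨_, fun w => DFunLike.congr_fun h2 w, fun w => DFunLike.congr_fun h1 w⟩

theorem exists_conj {K : Type} [Field K] {α Γ : Weyl K → Weyl K}
    (hα : IsExchange K α) (h : ConjToAlpha K α Γ) :
    ∃ G : Weyl K →ₐ[K] Weyl K, Function.Bijective G ∧ ∀ w, G (Γ w) = α (G w) := by
  obtain ⟨g, hg, rfl⟩ := h
  have hb : Function.Bijective g := by
    rcases hg with hg | hg
    · exact hg.2
    · exact hg.2
  have hr : ∀ w, g ((Function.invFun g ∘ α ∘ g) w) = α (g w) := fun w =>
    Function.rightInverse_invFun hb.2 _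
  rcases hg with hg | hg
  · obtain ⟨G, hG⟩ := endo_algHom hg.1
    obtain rfl : ⇑G = g := funext hG
    exact ⟨G, hb, hr⟩
  · obtain ⟨⟨⟨⟨hadd, hsmul, hmul, hone⟩, hbα⟩, hinv⟩, _⟩ := hα
    obtain ⟨⟨gadd, gsmul, gmul, gone⟩, _⟩ := hg
    obtain ⟨G, hG⟩ := endo_algHom (K := K) (f := α ∘ g)
      ⟨fun a b => by simp only [Function.comp_apply, gadd, hadd],
       fun c a => by simp only [Function.comp_apply, gsmul, hsmul],
       fun a b => by simp only [Function.comp_apply, gmul, hmul],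
       by simp only [Function.comp_apply, gone, hone]⟩
    refine ⟨G, ?_, fun w => ?_⟩
    · rw [show ⇑G = α ∘ g from funext hG]
      exact hbα.comp hb
    · rw [hG, hG, Function.comp_apply, hr]
      rfl

theorem sym_endo_bijective {K : Type} [Field K] [CharZero K] {α : Weyl K → Weyl K}
    (hα : IsExchange K α) (H : Weyl K →ₐ[K] Weyl K)
    (h1 : α (H (Wx K)) = H (Wy K)) (h2 : α (H (Wy K)) = H (Wx K)) : Function.Bijective H := by
  have hinj : Function.Injective (rot K) := Function.LeftInverse.injective (rot'_rot K)
  have hrb : Function.Bijective (rot K) := Function.bijective_iff_has_inverse.2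
    ⟨rot' K, rot'_rot K, rot_rot' K⟩
  have hrb' : Function.Bijective (rot' K) := Function.bijective_iff_has_inverse.2
    ⟨rot K, rot_rot' K, rot'_rot K⟩
  obtain ⟨F, hF⟩ : ∃ F : Weyl K →ₐ[K] Weyl K, F = ((rot' K).comp H).comp (rot K) := ⟨_, rfl⟩
  have hrF : ∀ w, rot K (F w) = H (rot K w) := by
    intro w; rw [hF]; exact rot_rot' K _
  obtain ⟨⟨⟨hadd, hsmul, hmul, hone⟩, _⟩, _⟩ := hα.1
  have hrel : F (Wy K) * F (Wx K) = F (Wx K) * F (Wy K) + 1 := by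
    rw [← map_mul, W_rel, map_add, map_mul, map_one]
  have hS : tr (F (Wx K)) = F (Wx K) := by
    apply hinj
    rw [← alpha_rot hα, hrF, rot, wlift_x, map_add, hadd, h1, h2, add_comm]
  have hD : tr (F (Wy K)) = (-1 : K) • F (Wy K) := by
    apply hinj
    rw [← alpha_rot hα, map_smul, hrF, rot, wlift_y, map_add, map_smul, map_smul, hadd, hsmul,
      hsmul, h1, h2]
    module
  obtain ⟨c, t, hc, eD, eS⟩ := SD_form hrel hS hD
  have e : F = shear c hc t := by
    apply W_hom_ext
    · rw [eS, shear, wlift_x]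
    · rw [eD, shear, wlift_y]
  have hb := shear_bijective c hc t
  rw [← e, hF, AlgHom.coe_comp, AlgHom.coe_comp] at hb
  have hb2 := (Function.Bijective.of_comp_iff _ hrb).1 hb
  exact (Function.Bijective.of_comp_iff' hrb' _).1 hb2

theorem main_thm {K : Type} [Field K] [CharZero K]
    (α : Weyl K → Weyl K) (hα : IsExchange K α)
    (hB : ∀ γ : Weyl K → Weyl K, IsInvolutionOn K γ → ConjToAlpha K α γ)
    (f : Weyl K → Weyl K) (hf : IsAlgEndo K f)
    (Γ : Weyl K → Weyl K) (hΓ : IsInvolutionOn K Γ)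
    (hP : Γ (f (Wx K)) = f (Wy K)) (hQ : Γ (f (Wy K)) = f (Wx K)) :
    IsAlgAuto K f := by
  obtain ⟨G, hGb, hG⟩ := exists_conj hα (hB Γ hΓ)
  obtain ⟨F, hF⟩ := endo_algHom hf
  have hb := sym_endo_bijective hα (G.comp F)
    (by rw [AlgHom.comp_apply, AlgHom.comp_apply, ← hG, hF, hF, hP])
    (by rw [AlgHom.comp_apply, AlgHom.comp_apply, ← hG, hF, hF, hQ])
  rw [AlgHom.coe_comp] at hb
  have hb2 := (Function.Bijective.of_comp_iff' hGb _).1 hb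
  rw [show ⇑F = f from funext hF] at hb2
  exact ⟨hf, hb2⟩

end Part11

end Helpers

/-- extension condition, second version: assuming every involution on `A₁`
is conjugate to `α`, if some involution `Γ` on `A₁` exchanges `P = f X` and `Q = f Y`,
then `f` is an automorphism. -/
theorem stmt_10 {K : Type} [Field K] [CharZero K]
    (α : Weyl K → Weyl K) (hα : IsExchange K α)
    (hB : ∀ γ : Weyl K → Weyl K, IsInvolutionOn K γ → ConjToAlpha K α γ)
    (f : Weyl K → Weyl K) (hf : IsAlgEndo K f)
    (Γ : Weyl K → Weyl K) (hΓ : IsInvolutionOn K Γ)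
    (hP : Γ (f (Wx K)) = f (Wy K)) (hQ : Γ (f (Wy K)) = f (Wx K)) :
    IsAlgAuto K f := by
  exact main_thm α hα hB f hf Γ hΓ hP hQ
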